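/- arXiv:2010.08927 — 2 statements merged into one kernel-verified Lean document; each statement's English description precedes it below -/
import Mathlib

section
/- Let F(t,x,y) = y^d + Σ_{i=1}^d a_i(t,x) y^{d-i} be reduced, with a_i(0,0) = 0 and F vanishing on T = {x = y = 0}. If V(F) is an equisingular family of plane curve singularities (i.e. D_F(t,x) = x^M · unit(t,x)), then a_i(t,0) ≡ 0 for all i = 1,…,d. -/
open Polynomial Finset

/-- The monic polynomial `Z^d + Σ_{i=1}^d aᵢ Z^{d-i}` built from its list of coefficients. -/
noncomputable def mkPoly (d : ℕ) (a : Fin d → ℂ) : Polynomial ℂ :=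
  X ^ d + ∑ i : Fin d, C (a i) * X ^ (d - (i.val + 1))

/-- The discriminant `∏_{i<j} (ξⱼ - ξᵢ)²` of a (split, monic) complex polynomial, expressed
through its multiset of roots (with multiplicity). -/
noncomputable def polyDisc (p : Polynomial ℂ) : ℂ :=
  ∏ q ∈ (Finset.range p.roots.toList.length ×ˢ Finset.range p.roots.toList.length).filter
      (fun q => q.1 < q.2),
    (p.roots.toList.getD q.2 0 - p.roots.toList.getD q.1 0) ^ 2

open Topology Filter in
/-- The zero locus of `G` over `B`, when its fibres are finite and uniformly bounded and it is
locally the graph of a continuous function, is a covering of `B`. -/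
theorem isCoveringMap_fst_zeroLocus {B : Type*} [TopologicalSpace B] [T2Space B]
    {G : B × ℂ → ℂ} (hG : Continuous G) {K : ℝ} (hK : ∀ b y, G (b, y) = 0 → ‖y‖ ≤ K)
    (hfin : ∀ b, {y | G (b, y) = 0}.Finite)
    (hloc : ∀ b y, G (b, y) = 0 → ∃ φ : B → ℂ, φ b = y ∧
      (∀ᶠ b' in 𝓝 b, ContinuousAt φ b' ∧ G (b', φ b') = 0) ∧
      ∀ᶠ v in 𝓝 (b, y), G v = 0 → φ v.1 = v.2) :
    IsCoveringMap (fun e : {e : B × ℂ // G e = 0} => e.1.1) := by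
  have hclosed : IsClosedMap (fun e : {e : B × ℂ // G e = 0} => e.1.1) := by
    have : CompactSpace (Metric.closedBall (0 : ℂ) K) :=
      isCompact_iff_compactSpace.mp (isCompact_closedBall _ _)
    let j : {e : B × ℂ // G e = 0} → B × Metric.closedBall (0 : ℂ) K :=
      fun e => (e.1.1, ⟨e.1.2, by simpa using hK e.1.1 e.1.2 e.2⟩)
    have hj : IsClosedMap j := by
      have hcomp : IsClosedEmbedding
          ((Prod.map id Subtype.val : B × Metric.closedBall (0 : ℂ) K → B × ℂ) ∘ j) :=
        (isClosed_singleton.preimage hG : IsClosed {e | G e = 0}).isClosedEmbedding_subtypeVal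
      exact (IsClosedEmbedding.of_comp (IsEmbedding.id.prodMap .subtypeVal) hcomp).isClosedMap
    exact (isClosedMap_fst_of_compactSpace (Y := Metric.closedBall (0 : ℂ) K)).comp hj
  rw [isCoveringMap_iff_isCoveringMapOn_univ]
  refine hclosed.isCoveringMapOn_of_isLocalHomeomorphOn (fun b _ => ?_) ?_
  · refine Set.Finite.of_finite_image (f := fun e => e.1.2) ((hfin b).subset ?_) ?_
    · rintro _ ⟨⟨⟨b', y⟩, he⟩, hb, rfl⟩
      obtain rfl : b' = b := hb
      exact he
    · rintro ⟨⟨b₁, y₁⟩, h₁⟩ hb₁ ⟨⟨b₂, y₂⟩, h₂⟩ hb₂ h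
      obtain rfl : b₁ = b := hb₁
      obtain rfl : b₂ = b₁ := hb₂
      exact Subtype.ext (Prod.ext rfl h)
  · refine IsLocalHomeomorphOn.mk _ _ ?_
    rintro ⟨⟨b, y⟩, he⟩ -
    obtain ⟨φ, rfl, hφ, huniq⟩ := hloc b y he
    obtain ⟨V, hV, hVo, hbV⟩ := eventually_nhds_iff.mp hφ
    obtain ⟨N, hN, hNo, hbN⟩ := eventually_nhds_iff.mp huniq
    have hφc : ContinuousOn φ V := fun b' hb' => (hV b' hb').1.continuousWithinAt
    have hV'o : IsOpen (V ∩ (fun b' => (b', φ b')) ⁻¹' N) :=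
      (continuousOn_id.prodMk hφc).isOpen_inter_preimage hVo hNo
    set V' := V ∩ (fun b' => (b', φ b')) ⁻¹' N with hV'
    classical
    refine ⟨{ toFun := fun e => e.1.1
              invFun := fun b' => if h : G (b', φ b') = 0 then ⟨(b', φ b'), h⟩ else ⟨(b, φ b), he⟩
              source := {e | e.1.1 ∈ V' ∧ e.1 ∈ N}
              target := V'
              map_source' := fun e he => he.1
              map_target' := fun b' hb' => ?_
              left_inv' := ?_
              right_inv' := fun b' hb' => ?_
              open_source := ?_
              open_target := hV'o
              continuousOn_toFun := by fun_prop
              continuousOn_invFun := ?_ }, ⟨⟨hbV, hbN⟩, hbN⟩, fun _ _ => rfl⟩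
    · simp only [(hV b' hb'.1).2, dite_true]
      exact ⟨hb', hb'.2⟩
    · rintro ⟨⟨b', y⟩, he'⟩ ⟨h₁, h₂⟩
      have : φ b' = y := hN _ h₂ he'
      subst this
      simp only [he', dite_true]
    · simp [(hV b' hb'.1).2]
    · refine (IsInducing.continuousOn_iff
        (g := (Subtype.val : {e : B × ℂ // G e = 0} → B × ℂ)) ⟨rfl⟩).mpr ?_
      refine (continuousOn_id.prodMk (hφc.mono Set.inter_subset_left)).congr fun b' hb' => ?_
      simp [(hV b' hb'.1).2]
    · exact (hV'o.preimage (continuous_fst.comp continuous_subtype_val)).inter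
        (hNo.preimage continuous_subtype_val)

open Complex Metric in
/-- A Harnack-type inequality for nonvanishing holomorphic functions bounded by `1`. -/
theorem norm_pow_three_le_of_ne_zero {g : ℂ → ℂ} {c z : ℂ} {R : ℝ}
    (hg : DifferentiableOn ℂ g (ball c R)) (hg0 : ∀ w ∈ ball c R, g w ≠ 0)
    (hg1 : ∀ w ∈ ball c R, ‖g w‖ ≤ 1) (hR : 0 < R) (hz : 2 * ‖z - c‖ ≤ R) :
    ‖g c‖ ^ 3 ≤ ‖g z‖ := by
  have hc : c ∈ ball c R := mem_ball_self hR
  have hzb : z ∈ ball c R := by rw [mem_ball, dist_eq_norm]; linarith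
  have hlog : DifferentiableOn ℂ (fun w => deriv g w / g w) (ball c R) :=
    (hg.deriv isOpen_ball).div hg hg0
  obtain ⟨h, hhc, hh⟩ := hlog.isExactOn_ball.with_val_at c (Real.log ‖g c‖ : ℂ)
  have hconst : ∀ w ∈ ball c R, exp (-h w) * g w = exp (-h c) * g c := by
    intro w hw
    have hder : ∀ v ∈ ball c R, HasDerivAt (fun v => exp (-h v) * g v) 0 v := by
      intro v hv
      have h1 := (hh v hv).neg.cexp.mul
        ((hg v hv).differentiableAt (isOpen_ball.mem_nhds hv)).hasDerivAt
      refine h1.congr_deriv ?_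
      have := hg0 v hv
      field_simp
      ring
    exact (convex_ball c R).is_const_of_fderivWithin_eq_zero (𝕜 := ℂ)
      (fun v hv => (hder v hv).differentiableAt.differentiableWithinAt)
      (fun v hv => by
        have := (hder v hv).hasFDerivAt.hasFDerivWithinAt (s := ball c R)
        rw [this.fderivWithin (isOpen_ball.uniqueDiffWithinAt hv)]
        ext; simp) hw hc
  have hre : ∀ w ∈ ball c R, (h w).re = Real.log ‖g w‖ := by
    intro w hw
    have h1 := congrArg norm (hconst w hw)
    have hgc : 0 < ‖g c‖ := norm_pos_iff.mpr (hg0 c hc)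
    have hgw : 0 < ‖g w‖ := norm_pos_iff.mpr (hg0 w hw)
    rw [norm_mul, norm_mul, norm_exp, norm_exp, hhc, neg_re, neg_re, ofReal_re, Real.exp_neg,
      Real.exp_neg, Real.exp_log hgc, inv_mul_cancel₀ hgc.ne'] at h1
    have h2 : ‖g w‖ = Real.exp (h w).re := by
      field_simp at h1
      exact h1
    rw [h2, Real.log_exp]
  have hbound : ∀ M : ℝ, 0 < M → ‖h z‖ ≤ 3 * ‖h c‖ + M := by
    intro M hM
    have hsh : ∀ w ∈ ball (0 : ℂ) R, w + c ∈ ball c R := fun w hw => by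
      simpa [mem_ball, dist_eq_norm] using hw
    have hd : DifferentiableOn ℂ h (ball c R) :=
      fun v hv => (hh v hv).differentiableAt.differentiableWithinAt
    have := borelCaratheodory (f := fun w => h (w + c)) (M := M / 2) (R := R) (z := z - c)
      (by positivity) (hd.comp (by fun_prop) hsh)
      (fun w hw => by
        have := Real.log_nonpos (norm_nonneg _) (hg1 _ (hsh w hw))
        simp only [Set.mem_ofPred_eq, hre _ (hsh w hw)]
        linarith) hR (by simpa [mem_ball, dist_eq_norm] using hzb)
    simp only [sub_add_cancel, zero_add] at this
    have hpos : 0 < R - ‖z - c‖ := by linarith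
    have e1 : 2 * (M / 2) * ‖z - c‖ / (R - ‖z - c‖) ≤ M := by
      rw [div_le_iff₀ hpos]; nlinarith
    have e2 : ‖h c‖ * (R + ‖z - c‖) / (R - ‖z - c‖) ≤ 3 * ‖h c‖ := by
      rw [div_le_iff₀ hpos]; nlinarith [norm_nonneg (h c)]
    linarith
  have hle : ‖h z‖ ≤ 3 * ‖h c‖ := le_of_forall_pos_le_add hbound
  have hnc : ‖h c‖ = -Real.log ‖g c‖ := by
    rw [hhc, norm_real, Real.norm_eq_abs,
      abs_of_nonpos (Real.log_nonpos (norm_nonneg _) (hg1 c hc))]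
  have hzre : -‖h z‖ ≤ Real.log ‖g z‖ := by
    rw [← hre z hzb]; exact neg_le_of_abs_le (abs_re_le_norm _)
  have hgc : 0 < ‖g c‖ := norm_pos_iff.mpr (hg0 c hc)
  rw [← Real.log_le_log_iff (by positivity) (norm_pos_iff.mpr (hg0 z hzb)), Real.log_pow]
  push_cast
  linarith

open Topology Filter in
/-- The implicit function theorem at a simple zero `y` of `f (s, ·)`. -/
theorem exists_implicit_of_deriv_ne_zero {f : ℂ × ℂ → ℂ} {s y : ℂ}
    (hf : ContDiffAt ℂ 1 f (s, y)) (h0 : f (s, y) = 0)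
    (hder : deriv (fun y => f (s, y)) y ≠ 0) :
    ∃ φ : ℂ → ℂ, φ s = y ∧ (∀ᶠ s' in 𝓝 s, ContinuousAt φ s' ∧ f (s', φ s') = 0) ∧
      (∀ᶠ v in 𝓝 (s, y), f v = 0 → φ v.1 = v.2) ∧ DifferentiableAt ℂ φ s := by
  have hinv : (fderiv ℂ f (s, y) ∘L .inr ℂ ℂ ℂ).IsInvertible := by
    refine ⟨ContinuousLinearEquiv.unitsEquivAut ℂ (Units.mk0 _ hder), ?_⟩
    have h1 : HasFDerivAt (fun y => f (s, y)) (fderiv ℂ f (s, y) ∘L .inr ℂ ℂ ℂ) y :=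
      (hf.differentiableAt one_ne_zero).hasFDerivAt.comp y (hasFDerivAt_prodMk_right s y)
    ext
    simp [h1.hasDerivAt.deriv]
  have hφ := hf.contDiffAt_implicitFunction one_ne_zero hinv
  refine ⟨hf.implicitFunction one_ne_zero hinv, hf.implicitFunction_apply_self one_ne_zero hinv,
    ?_, ?_, hφ.differentiableAt one_ne_zero⟩
  · filter_upwards [hφ.eventually (by simp), hf.eventually_apply_implicitFunction one_ne_zero hinv]
      with s' h1 h2
    exact ⟨h1.continuousAt, h2.trans h0⟩
  · filter_upwards [hf.eventually_apply_eq_iff_implicitFunction one_ne_zero hinv] with v hv h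
    exact hv.mp (h.trans h0.symm)

open Topology Filter Metric in
/-- If `f (s, ·)` has finitely many zeros, uniformly bounded and all simple, for every `s` in a
disc, then two distinct zeros over the centre extend to disjoint holomorphic families of zeros. -/
theorem exists_differentiableOn_zeros {f : ℂ × ℂ → ℂ} {c y₁ y₂ : ℂ} {R K : ℝ} (hR : 0 < R)
    (hf : ∀ s ∈ ball c R, ∀ y, ContDiffAt ℂ 1 f (s, y))
    (hK : ∀ s ∈ ball c R, ∀ y, f (s, y) = 0 → ‖y‖ ≤ K)
    (hfin : ∀ s ∈ ball c R, {y | f (s, y) = 0}.Finite)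
    (hder : ∀ s ∈ ball c R, ∀ y, f (s, y) = 0 → deriv (fun y => f (s, y)) y ≠ 0)
    (h₁ : f (c, y₁) = 0) (h₂ : f (c, y₂) = 0) (hne : y₁ ≠ y₂) :
    ∃ ξ₁ ξ₂ : ℂ → ℂ, DifferentiableOn ℂ ξ₁ (ball c R) ∧ DifferentiableOn ℂ ξ₂ (ball c R) ∧
      ξ₁ c = y₁ ∧ ξ₂ c = y₂ ∧
      ∀ s ∈ ball c R, f (s, ξ₁ s) = 0 ∧ f (s, ξ₂ s) = 0 ∧ ξ₁ s ≠ ξ₂ s := by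
  have hc : c ∈ ball c R := mem_ball_self hR
  let G : ball c R × ℂ → ℂ := fun e => f (e.1.1, e.2)
  have hG : Continuous G := continuous_iff_continuousAt.mpr fun e =>
    (hf e.1.1 e.1.2 e.2).continuousAt.comp (f := fun e : ball c R × ℂ => (e.1.1, e.2))
      (by fun_prop)
  have hcov : IsCoveringMap (fun e : {e : ball c R × ℂ // G e = 0} => e.1.1) := by
    refine isCoveringMap_fst_zeroLocus hG (fun b y => hK b.1 b.2 y) (fun b => hfin b.1 b.2) ?_
    intro b y hby
    obtain ⟨φ, h1, h2, h3, -⟩ :=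
      exists_implicit_of_deriv_ne_zero (hf b.1 b.2 y) hby (hder b.1 b.2 y hby)
    have hval : Tendsto (Subtype.val : ball c R → ℂ) (𝓝 b) (𝓝 b.1) := continuousAt_subtype_val
    refine ⟨fun b' => φ b'.1, h1, ?_, ?_⟩
    · filter_upwards [hval.eventually h2] with b' hb'
      exact ⟨hb'.1.comp continuousAt_subtype_val, hb'.2⟩
    · have : Tendsto (fun v : ball c R × ℂ => (v.1.1, v.2)) (𝓝 (b, y)) (𝓝 (b.1, y)) :=
        (by fun_prop : Continuous fun v : ball c R × ℂ => (v.1.1, v.2)).tendsto _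
      exact this.eventually h3
  have : ContractibleSpace (ball c R) := contractibleSpace_ball hR
  have : LocallyPathConnectedSpace (ball c R) := isOpen_ball.locallyPathConnectedSpace
  have hlift : ∀ y, f (c, y) = 0 → ∃ F : C(ball c R, {e : ball c R × ℂ // G e = 0}),
      (F ⟨c, hc⟩).1.2 = y ∧ ∀ b, (F b).1.1 = b := by
    intro y hy
    obtain ⟨F, ⟨hF, hFp⟩, -⟩ := hcov.existsUnique_continuousMap_lifts
      (ContinuousMap.id (ball c R)) ⟨c, hc⟩ ⟨(⟨c, hc⟩, y), hy⟩ rfl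
    exact ⟨F, by rw [hF], fun b => congrFun hFp b⟩
  have hzero : ∀ F : C(ball c R, {e : ball c R × ℂ // G e = 0}), (∀ b, (F b).1.1 = b) →
      ∀ b : ball c R, f (b.1, (F b).1.2) = 0 := by
    intro F hF b
    have := (F b).2
    simp only [G, hF b] at this
    exact this
  classical
  have hdiff : ∀ F : C(ball c R, {e : ball c R × ℂ // G e = 0}), (∀ b, (F b).1.1 = b) →
      DifferentiableOn ℂ (fun s => if h : s ∈ ball c R then (F ⟨s, h⟩).1.2 else 0)
        (ball c R) := by
    intro F hF s hs
    set ξ : ℂ → ℂ := fun s => if h : s ∈ ball c R then (F ⟨s, h⟩).1.2 else 0 with hξ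
    have hξb : ∀ b : ball c R, ξ b.1 = (F b).1.2 := fun b => by simp only [hξ, b.2, dite_true]
    have hξc : ContinuousAt ξ s := by
      refine ContinuousOn.continuousAt ?_ (isOpen_ball.mem_nhds hs)
      rw [continuousOn_iff_continuous_domRestrict]
      have : (ball c R).domRestrict ξ = fun b => (F b).1.2 := funext hξb
      rw [this]
      fun_prop
    have hs0 : f (s, ξ s) = 0 := by
      simpa only [hξb ⟨s, hs⟩] using hzero F hF ⟨s, hs⟩
    obtain ⟨φ, -, -, h3, h4⟩ :=
      exists_implicit_of_deriv_ne_zero (hf s hs _) hs0 (hder s hs _ hs0)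
    have hev : φ =ᶠ[𝓝 s] ξ := by
      filter_upwards [(continuousAt_id.prodMk hξc).eventually h3, isOpen_ball.mem_nhds hs]
        with s' h1 h2
      exact h1 (by simpa only [hξb ⟨s', h2⟩, id] using hzero F hF ⟨s', h2⟩)
    exact (hev.differentiableAt_iff.mp h4).differentiableWithinAt
  obtain ⟨F₁, hF₁, hp₁⟩ := hlift y₁ h₁
  obtain ⟨F₂, hF₂, hp₂⟩ := hlift y₂ h₂
  refine ⟨_, _, hdiff F₁ hp₁, hdiff F₂ hp₂, by simpa only [hc, dite_true] using hF₁,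
    by simpa only [hc, dite_true] using hF₂, fun s hs => ?_⟩
  simp only [hs, dite_true]
  refine ⟨hzero F₁ hp₁ ⟨s, hs⟩, hzero F₂ hp₂ ⟨s, hs⟩, fun h => hne ?_⟩
  have heq : F₁ = F₂ := DFunLike.coe_injective <|
    hcov.eq_of_comp_eq F₁.continuous F₂.continuous
      (funext fun b => (hp₁ b).trans (hp₂ b).symm) ⟨s, hs⟩
      (Subtype.ext (Prod.ext ((hp₁ _).trans (hp₂ _).symm) h))
  rw [← hF₁, ← hF₂, heq]

theorem eval_mkPoly (d : ℕ) (a : Fin d → ℂ) (y : ℂ) :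
    (mkPoly d a).eval y = y ^ d + ∑ i : Fin d, a i * y ^ (d - (i.val + 1)) := by
  simp [mkPoly, eval_finsetSum]

theorem degree_sum_mkPoly_lt (d : ℕ) (a : Fin d → ℂ) :
    (∑ i : Fin d, C (a i) * X ^ (d - (i.val + 1))).degree < (d : WithBot ℕ) := by
  refine (degree_sum_le _ _).trans_lt ((Finset.sup_lt_iff (WithBot.bot_lt_coe d)).mpr ?_)
  intro i _
  refine (degree_C_mul_X_pow_le _ _).trans_lt ?_
  exact Nat.cast_lt.mpr (by omega)

theorem monic_mkPoly (d : ℕ) (a : Fin d → ℂ) : (mkPoly d a).Monic :=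
  monic_X_pow_add (degree_sum_mkPoly_lt d a)

theorem natDegree_mkPoly (d : ℕ) (a : Fin d → ℂ) : (mkPoly d a).natDegree = d := by
  refine natDegree_eq_of_degree_eq_some ?_
  rw [mkPoly, degree_add_eq_left_of_degree_lt] <;> rw [degree_X_pow]
  exact degree_sum_mkPoly_lt d a

theorem coeff_mkPoly (d : ℕ) (a : Fin d → ℂ) (i : Fin d) :
    (mkPoly d a).coeff (d - (i.val + 1)) = a i := by
  rw [mkPoly, coeff_add, coeff_X_pow, if_neg (by omega), zero_add, finsetSum_coeff,
    Finset.sum_eq_single i]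
  · simp
  · intro j _ hj
    rw [coeff_C_mul_X_pow, if_neg fun h => hj (Fin.ext (by omega))]
  · simp

theorem norm_lt_of_eval_mkPoly_eq_zero {d : ℕ} {a : Fin d → ℂ} {y : ℂ} {ε : ℝ} (hε : 0 < ε)
    (ha : ∑ i, ‖a i‖ / ε ^ (i.val + 1) < 1) (hy : (mkPoly d a).eval y = 0) : ‖y‖ < ε := by
  by_contra! h
  have hy0 : 0 < ‖y‖ := hε.trans_le h
  rw [eval_mkPoly] at hy
  have h1 : ‖y‖ ^ d ≤ (∑ i, ‖a i‖ / ε ^ (i.val + 1)) * ‖y‖ ^ d := by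
    calc ‖y‖ ^ d = ‖∑ i : Fin d, a i * y ^ (d - (i.val + 1))‖ := by
          rw [← norm_pow, eq_neg_of_add_eq_zero_left hy, norm_neg]
      _ ≤ ∑ i : Fin d, ‖a i * y ^ (d - (i.val + 1))‖ := norm_sum_le _ _
      _ ≤ ∑ i : Fin d, ‖a i‖ / ε ^ (i.val + 1) * ‖y‖ ^ d := by
          refine Finset.sum_le_sum fun i _ => ?_
          have hsplit : ‖y‖ ^ d = ‖y‖ ^ (i.val + 1) * ‖y‖ ^ (d - (i.val + 1)) := by
            rw [← pow_add]; congr 1; omega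
          rw [norm_mul, norm_pow, hsplit, div_mul_eq_mul_div, le_div_iff₀ (by positivity)]
          have : ε ^ (i.val + 1) ≤ ‖y‖ ^ (i.val + 1) := by gcongr
          calc ‖a i‖ * ‖y‖ ^ (d - (i.val + 1)) * ε ^ (i.val + 1)
              ≤ ‖a i‖ * ‖y‖ ^ (d - (i.val + 1)) * ‖y‖ ^ (i.val + 1) := by gcongr
            _ = _ := by ring
      _ = _ := by rw [Finset.sum_mul]
  have : 0 < ‖y‖ ^ d := by positivity
  nlinarith

theorem exists_root_norm_sub_lt {p : ℂ[X]} (hp : p.Monic) {z : ℂ} {ε : ℝ} (hε : 0 < ε)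
    (hz : ‖p.eval z‖ < ε ^ p.natDegree) : ∃ y, p.eval y = 0 ∧ ‖z - y‖ < ε := by
  by_contra! h
  have hs := IsAlgClosed.splits p
  have heval : p.eval z = (p.roots.map (z - ·)).prod := by
    conv_lhs => rw [hs.eq_prod_roots_of_monic hp]
    simp [eval_multiset_prod, Multiset.map_map]
  have hnorm : ‖p.eval z‖ = (p.roots.map (‖z - ·‖)).prod := by
    rw [heval, ← normHom_apply, map_multiset_prod, Multiset.map_map]
    rfl
  refine hz.not_ge ?_
  rw [hnorm, hs.natDegree_eq_card_roots]
  have := Multiset.prod_map_le_prod_map₀ (s := p.roots) (fun _ => ε) (fun y => ‖z - y‖)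
    (fun _ _ => hε.le) (fun y hy => h y (isRoot_of_mem_roots hy))
  simpa using this

theorem nodup_roots_of_polyDisc_ne_zero {p : ℂ[X]} (hp : polyDisc p ≠ 0) : p.roots.Nodup := by
  rw [← Multiset.coe_toList p.roots, Multiset.coe_nodup, List.nodup_iff_pairwise_ne,
    List.pairwise_iff_getElem]
  intro i j hi hj hij heq
  refine hp (Finset.prod_eq_zero (i := (i, j)) ?_ ?_)
  · simp only [mem_filter, mem_product, Finset.mem_range]
    exact ⟨⟨hi, hj⟩, hij⟩
  · rw [List.getD_eq_getElem _ _ hi, List.getD_eq_getElem _ _ hj, heq, sub_self,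
      zero_pow two_ne_zero]

theorem eval_derivative_ne_zero_of_nodup_roots {p : ℂ[X]} (hp : p ≠ 0) (hn : p.roots.Nodup)
    {y : ℂ} (hy : p.eval y = 0) : p.derivative.eval y ≠ 0 := by
  have hsep := (nodup_roots_iff_of_splits hp (IsAlgClosed.splits p)).mp hn
  exact hsep.aeval_derivative_ne_zero (x := y) (by simpa using hy)

theorem eq_zero_of_forall_root_mkPoly {d : ℕ} {a : Fin d → ℂ}
    (h : ∀ y, (mkPoly d a).eval y = 0 → y = 0) (i : Fin d) : a i = 0 := by
  have hs := IsAlgClosed.splits (mkPoly d a)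
  have hr : (mkPoly d a).roots = Multiset.replicate d 0 := by
    refine Multiset.eq_replicate.mpr ⟨?_, fun y hy => h y (isRoot_of_mem_roots hy)⟩
    rw [← hs.natDegree_eq_card_roots, natDegree_mkPoly]
  have hX : mkPoly d a = X ^ d := by
    rw [hs.eq_prod_roots_of_monic (monic_mkPoly d a), hr]
    simp
  rw [← coeff_mkPoly d a i, hX, coeff_X_pow, if_neg (by omega)]

/-- Let `F(t,x,y) = y^d + Σ aᵢ(t,x) y^{d-i}` be reduced, with `aᵢ(0,0) = 0`
and `F` vanishing on `T = {x = y = 0}`.  If `V(F)` is an equisingular family of plane curve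
singularities, i.e. `D_F(t,x) = x^M · unit(t,x)`, then `aᵢ(t,0) ≡ 0` for all `i`. -/
theorem coefficients_vanish_on_T_of_equisingular
    (l d M : ℕ) (hd : 0 < d)
    (a : Fin d → (Fin l → ℂ) × ℂ → ℂ)
    (W : Set ((Fin l → ℂ) × ℂ)) (hW : W ∈ nhds (0 : (Fin l → ℂ) × ℂ))
    (ha : ∀ i, AnalyticOnNhd ℂ (a i) W)
    (ha0 : ∀ i, a i 0 = 0)
    -- `F` is reduced: its discriminant does not vanish identically near `0`
    (hred : ¬ ∀ᶠ p in nhds (0 : (Fin l → ℂ) × ℂ), polyDisc (mkPoly d fun i => a i p) = 0)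
    -- `T ⊂ V(F)`, i.e. `F(t,0,0) ≡ 0`
    (hT : ∀ t : Fin l → ℂ, (t, (0 : ℂ)) ∈ W →
      Polynomial.eval 0 (mkPoly d fun i => a i (t, 0)) = 0)
    -- equisingularity: `D_F(t,x) = x^M · unit(t,x)`
    (u : (Fin l → ℂ) × ℂ → ℂ) (hu : AnalyticOnNhd ℂ u W) (hu0 : ∀ p ∈ W, u p ≠ 0)
    (hdisc : ∀ p ∈ W, polyDisc (mkPoly d fun i => a i p) = p.2 ^ M * u p) :
    ∀ᶠ t in nhds (0 : Fin l → ℂ), ∀ i, a i (t, 0) = 0 := by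
  have hac : ∀ i, ContinuousAt (a i) 0 := fun i => (ha i 0 (mem_of_mem_nhds hW)).continuousAt
  have hsmall : ∀ ε : ℝ, 0 < ε →
      ∀ᶠ p in nhds (0 : (Fin l → ℂ) × ℂ), ∑ i, ‖a i p‖ / ε ^ (i.val + 1) < 1 := by
    intro ε hε
    have hcont : ContinuousAt (fun p => ∑ i, ‖a i p‖ / ε ^ (i.val + 1)) 0 :=
      tendsto_finsetSum _ fun i _ => (hac i).norm.div_const _
    exact hcont.eventually_lt_const (by simp [ha0])
  obtain ⟨r, hr, hball⟩ := Metric.eventually_nhds_iff_ball.mp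
    (Filter.Eventually.and hW (hsmall (1 / 4) (by norm_num)))
  have hmem : ∀ (t : Fin l → ℂ) (x : ℂ), ‖t‖ < r → ‖x‖ < r →
      (t, x) ∈ Metric.ball (0 : (Fin l → ℂ) × ℂ) r := by
    intro t x ht hx
    rw [mem_ball_zero_iff, Prod.norm_def]
    exact max_lt ht hx
  filter_upwards [Metric.ball_mem_nhds (0 : Fin l → ℂ) (by positivity : 0 < r / 4)] with t ht
  rw [mem_ball_zero_iff] at ht
  refine eq_zero_of_forall_root_mkPoly fun ρ hρ => ?_
  by_contra hρ0
  have htW : (t, (0 : ℂ)) ∈ W := (hball _ (hmem t 0 (by linarith) (by simpa using hr))).1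
  set ε := ‖ρ‖ / 4 with hε_def
  have hε : 0 < ε := by positivity
  have hclose : ∀ y, (mkPoly d fun i => a i (t, 0)).eval y = 0 →
      ∀ᶠ x in nhds (0 : ℂ), ‖(mkPoly d fun i => a i (t, x)).eval y‖ < ε ^ d := by
    intro y hy
    have hai : ∀ i, ContinuousAt (fun x : ℂ => a i (t, x)) 0 := fun i =>
      (ha i _ htW).continuousAt.comp (f := fun x : ℂ => (t, x)) (by fun_prop)
    have hcont : ContinuousAt (fun x : ℂ => ‖(mkPoly d fun i => a i (t, x)).eval y‖) 0 := by
      simp only [eval_mkPoly]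
      exact (continuousAt_const.add
        (tendsto_finsetSum _ fun i _ => (hai i).mul continuousAt_const)).norm
    exact hcont.eventually_lt_const (by beta_reduce; rw [hy, norm_zero]; positivity)
  have hfibre : ∀ᶠ x in nhds (0 : ℂ), ∑ i, ‖a i (0, x)‖ / (ε ^ 3) ^ (i.val + 1) < 1 :=
    (by fun_prop : Continuous fun x : ℂ => ((0 : Fin l → ℂ), x)).tendsto 0 |>.eventually
      (hsmall (ε ^ 3) (by positivity))
  obtain ⟨x, ⟨hxr, hx0, hxρ, hxf⟩, hx⟩ := ((eventually_nhdsWithin_of_eventually_nhds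
    (Filter.Eventually.and (Metric.ball_mem_nhds (0 : ℂ) hr)
      ((hclose 0 (hT t htW)).and ((hclose ρ hρ).and hfibre)))).and
    (self_mem_nhdsWithin : {(0 : ℂ)}ᶜ ∈ nhdsWithin (0 : ℂ) {0}ᶜ)).exists
  replace hxr : ‖x‖ < r := mem_ball_zero_iff.mp hxr
  obtain ⟨y₁, hy₁, hy₁ε⟩ := exists_root_norm_sub_lt (monic_mkPoly d fun i => a i (t, x)) hε
    (z := 0) (by rwa [natDegree_mkPoly])
  obtain ⟨y₂, hy₂, hy₂ε⟩ := exists_root_norm_sub_lt (monic_mkPoly d fun i => a i (t, x)) hε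
    (z := ρ) (by rwa [natDegree_mkPoly])
  have hdist : 2 * ε < ‖y₁ - y₂‖ := by
    have h1 : ‖ρ‖ ≤ ‖ρ - y₂‖ + ‖0 - y₁‖ + ‖y₁ - y₂‖ := by
      calc ‖ρ‖ = ‖(ρ - y₂) - (0 - y₁) - (y₁ - y₂)‖ := by congr 1; ring
        _ ≤ _ := (norm_sub_le _ _).trans (by gcongr; exact norm_sub_le _ _)
    linarith
  have hne : y₁ ≠ y₂ := by
    rintro rfl
    rw [sub_self, norm_zero] at hdist
    linarith
  have hs : ∀ s ∈ Metric.ball (1 : ℂ) 3, (s • t, x) ∈ Metric.ball (0 : (Fin l → ℂ) × ℂ) r := by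
    intro s hs
    refine hmem _ _ ?_ hxr
    have h4 : ‖s‖ ≤ 4 := by
      have h1 := norm_le_norm_add_norm_sub' s 1
      rw [mem_ball_iff_norm] at hs
      rw [norm_one] at h1
      linarith
    rw [norm_smul]
    nlinarith [norm_nonneg t]
  set f : ℂ × ℂ → ℂ := fun v => (mkPoly d fun i => a i (v.1 • t, x)).eval v.2 with hf_def
  have hf : ∀ s ∈ Metric.ball (1 : ℂ) 3, ∀ y, ContDiffAt ℂ 1 f (s, y) := by
    intro s hs' y
    have hai : ∀ i, ContDiffAt ℂ 1 (fun v : ℂ × ℂ => a i (v.1 • t, x)) (s, y) := fun i =>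
      (ha i _ (hball _ (hs s hs')).1).contDiffAt.comp (f := fun v : ℂ × ℂ => (v.1 • t, x)) (s, y)
        (by fun_prop)
    simp only [hf_def, eval_mkPoly]
    exact (contDiffAt_snd.pow d).add
      (ContDiffAt.sum fun i _ => (hai i).mul (contDiffAt_snd.pow _))
  have hroot : ∀ s ∈ Metric.ball (1 : ℂ) 3, ∀ y, f (s, y) = 0 → ‖y‖ ≤ 1 / 4 := fun s hs' y hy =>
    (norm_lt_of_eval_mkPoly_eq_zero (by norm_num) (hball _ (hs s hs')).2 hy).le
  obtain ⟨ξ₁, ξ₂, hξ₁, hξ₂, h₁, h₂, hξ⟩ := exists_differentiableOn_zeros (f := f) (c := 1)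
    (R := 3) (by norm_num) hf hroot
    (fun s _ => (finite_setOfPred_isRoot (monic_mkPoly d fun i => a i (s • t, x)).ne_zero))
    (fun s hs' y hy => by
      have hsW := hball _ (hs s hs')
      rw [show (fun y => f (s, y)) = fun y => (mkPoly d fun i => a i (s • t, x)).eval y from rfl,
        Polynomial.deriv]
      refine eval_derivative_ne_zero_of_nodup_roots (monic_mkPoly d _).ne_zero
        (nodup_roots_of_polyDisc_ne_zero ?_) hy
      rw [hdisc _ hsW.1]
      exact mul_ne_zero (pow_ne_zero _ hx) (hu0 _ hsW.1))
    (y₁ := y₁) (y₂ := y₂) (by simpa [hf_def] using hy₁) (by simpa [hf_def] using hy₂) hne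
  have hharnack := norm_pow_three_le_of_ne_zero (g := fun s => ξ₁ s - ξ₂ s) (z := 0)
    (hξ₁.sub hξ₂) (fun s hs' => sub_ne_zero.mpr (hξ s hs').2.2)
    (fun s hs' => (norm_sub_le _ _).trans (by
      linarith [hroot s hs' _ (hξ s hs').1, hroot s hs' _ (hξ s hs').2.1]))
    (by norm_num) (by norm_num)
  have h0 : (0 : ℂ) ∈ Metric.ball (1 : ℂ) 3 := by simp
  have hzero : ∀ y, f (0, y) = 0 → ‖y‖ < ε ^ 3 := fun y hy =>
    norm_lt_of_eval_mkPoly_eq_zero (by positivity) hxf (by simpa [hf_def] using hy)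
  have hupper := norm_sub_le (ξ₁ 0) (ξ₂ 0)
  have hlower : (2 * ε) ^ 3 < ‖y₁ - y₂‖ ^ 3 := by gcongr
  simp only [h₁, h₂] at hharnack
  nlinarith [hzero _ (hξ 0 h0).1, hzero _ (hξ 0 h0).2.1, pow_pos hε 3]
end

section
/- Let F(t,x,y) = y^d + Σ a_i(t,x) y^{d-i} be reduced with a_i(0,0) = 0 and T ⊂ V(F). Then V(F) is an equisingular family of plane curve singularities (discriminant of the form x^M · unit) if and only if there are ξ̃_i ∈ ℂ{t,u}, i = 1,…,d, and strictly positive integers N and k_{ij} (i < j) such that F(t,u^N,y) = ∏_{i=1}^d (y - ξ̃_i(t,u)) and for each pair i < j, ξ̃_i - ξ̃_j = u^{k_{ij}} · unit(t,u). -/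
open Polynomial Finset

section Holomorphic

open Metric Set Filter Topology Interval

variable {E G : Type*} [NormedAddCommGroup E] [NormedSpace ℂ E]
  [NormedAddCommGroup G] [NormedSpace ℂ G]

/-- Cauchy estimate for the Fréchet derivative of a bounded holomorphic map on a ball. -/
theorem norm_fderiv_le_of_norm_le_ball {f : E → G} {x : E} {r M : ℝ} (hr : 0 < r)
    (hf : DifferentiableOn ℂ f (ball x r)) (hM : ∀ y ∈ ball x r, ‖f y‖ ≤ M) :
    ‖fderiv ℂ f x‖ ≤ 2 * M / r := by
  refine Complex.norm_fderiv_le_div_of_mapsTo_ball hf (fun y hy => ?_) hr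
  rw [mem_closedBall, dist_eq_norm]
  linarith [norm_sub_le (f y) (f x), hM y hy, hM x (mem_ball_self hr)]

/-- A circle integral depending holomorphically on a parameter is holomorphic. -/
theorem differentiableOn_circleIntegral_param [FiniteDimensional ℂ E] {g : E → ℂ → ℂ}
    {V : Set E} {Ω : Set (E × ℂ)} {c : ℂ} {R : ℝ} (hR : 0 ≤ R) (hΩ : IsOpen Ω)
    (hg : DifferentiableOn ℂ (fun p : E × ℂ => g p.1 p.2) Ω)
    (hV : V ×ˢ sphere c R ⊆ Ω) :
    DifferentiableOn ℂ (fun e => ∮ z in C(c, R), g e z) V := by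
  intro e₀ he₀
  have : ProperSpace E := FiniteDimensional.proper ℂ E
  have hcomp : IsCompact (({e₀} : Set E) ×ˢ sphere c R) :=
    isCompact_singleton.prod (isCompact_sphere c R)
  obtain ⟨δ, hδ, hδΩ⟩ := hcomp.exists_cthickening_subset_open hΩ
    ((prod_mono_left (singleton_subset_iff.2 he₀)).trans hV)
  have hsub : closedBall e₀ δ ×ˢ sphere c R ⊆ Ω := by
    rintro ⟨e, z⟩ ⟨he, hz⟩
    refine hδΩ (mem_cthickening_of_dist_le (e, z) (e₀, z) δ _ ⟨rfl, hz⟩ ?_)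
    simpa [Prod.dist_eq, hδ.le] using he
  have hcont : ContinuousOn (fun p : E × ℂ => g p.1 p.2) (closedBall e₀ δ ×ˢ sphere c R) :=
    hg.continuousOn.mono hsub
  obtain ⟨M, hM⟩ := ((isCompact_closedBall e₀ δ).prod (isCompact_sphere c R)).exists_bound_of_continuousOn hcont
  have hcirc : ∀ θ : ℝ, circleMap c R θ ∈ sphere c R := fun θ => circleMap_mem_sphere c hR θ
  have hmem : ∀ e ∈ closedBall e₀ δ, ∀ θ : ℝ, (e, circleMap c R θ) ∈ Ω :=
    fun e he θ => hsub ⟨he, hcirc θ⟩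
  have hdiff : ∀ e ∈ closedBall e₀ δ, ∀ θ : ℝ,
      HasFDerivAt (fun e => g e (circleMap c R θ))
        ((fderiv ℂ (fun p : E × ℂ => g p.1 p.2) (e, circleMap c R θ)).comp
          (ContinuousLinearMap.inl ℂ E ℂ)) e := by
    intro e he θ
    have h1 := ((hg.differentiableAt (hΩ.mem_nhds (hmem e he θ))).hasFDerivAt)
    exact HasFDerivAt.comp (g := fun p : E × ℂ => g p.1 p.2) (f := fun e => (e, circleMap c R θ)) e h1
      (hasFDerivAt_prodMk_left e (circleMap c R θ))
  have hcontθ : ∀ e ∈ closedBall e₀ δ, Continuous fun θ : ℝ => g e (circleMap c R θ) := by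
    intro e he
    have := hg.continuousOn.comp_continuous (f := fun θ : ℝ => (e, circleMap c R θ))
      (by fun_prop) (hmem e he)
    exact this
  have hball : ball e₀ (δ / 2) ⊆ closedBall e₀ δ :=
    (ball_subset_ball (by linarith)).trans ball_subset_closedBall
  have key := intervalIntegral.hasFDerivAt_integral_of_dominated_of_fderiv_le (𝕜 := ℂ)
    (μ := MeasureTheory.volume) (a := 0) (b := 2 * Real.pi) (x₀ := e₀) (s := ball e₀ (δ / 2))
    (F := fun e θ => deriv (circleMap c R) θ • g e (circleMap c R θ))
    (F' := fun e θ => deriv (circleMap c R) θ •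
      ((fderiv ℂ (fun p : E × ℂ => g p.1 p.2) (e, circleMap c R θ)).comp
          (ContinuousLinearMap.inl ℂ E ℂ)))
    (bound := fun _ => |R| * (2 * M / (δ / 2)))
    (ball_mem_nhds _ (by positivity)) ?_ ?_ ?_ ?_ ?_ ?_
  · exact key.differentiableAt.differentiableWithinAt
  · filter_upwards [closedBall_mem_nhds e₀ hδ] with e he
    have := hcontθ e he
    refine Continuous.aestronglyMeasurable ?_
    simp only [deriv_circleMap]
    exact ((continuous_circleMap 0 R).mul continuous_const).smul this
  · refine Continuous.intervalIntegrable ?_ _ _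
    have := hcontθ e₀ (mem_closedBall_self hδ.le)
    simp only [deriv_circleMap]
    exact ((continuous_circleMap 0 R).mul continuous_const).smul this
  · have hA : MeasureTheory.AEStronglyMeasurable (fun θ : ℝ => deriv (circleMap c R) θ)
        (MeasureTheory.volume.restrict (Ι 0 (2 * Real.pi))) := by
      refine Continuous.aestronglyMeasurable ?_
      simp only [deriv_circleMap]
      exact (continuous_circleMap 0 R).mul continuous_const
    borelize E
    borelize (E × ℂ →L[ℂ] ℂ)
    have hm : Measurable fun θ : ℝ =>
        fderiv ℂ (fun p : E × ℂ => g p.1 p.2) (e₀, circleMap c R θ) :=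
      (measurable_fderiv ℂ _).comp (Continuous.measurable (by fun_prop))
    have hc : Continuous fun T : E × ℂ →L[ℂ] ℂ => T.comp (ContinuousLinearMap.inl ℂ E ℂ) := by
      fun_prop
    exact hA.smul (hc.comp_stronglyMeasurable hm.stronglyMeasurable).aestronglyMeasurable
  · refine Eventually.of_forall fun θ _ e he => ?_
    rw [norm_smul, deriv_circleMap]
    have hb : ball e (δ / 2) ⊆ closedBall e₀ δ := by
      intro y hy
      rw [mem_ball] at he hy
      rw [mem_closedBall]
      linarith [dist_triangle y e e₀]
    have h1 := (hdiff e (hball he) θ).fderiv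
    rw [← h1]
    have h2 := norm_fderiv_le_of_norm_le_ball (M := M) (r := δ / 2) (x := e) (by positivity)
      (fun y hy => (hdiff y (hb hy) θ).differentiableAt.differentiableWithinAt)
      (fun y hy => hM (y, circleMap c R θ) ⟨hb hy, hcirc θ⟩)
    have : ‖circleMap 0 R θ * Complex.I‖ = |R| := by simp
    rw [this]
    exact mul_le_mul_of_nonneg_left h2 (abs_nonneg R)
  · exact intervalIntegrable_const
  · exact Eventually.of_forall fun θ _ e he => (hdiff e (hball he) θ).fun_const_smul _

theorem DifferentiableOn.fderiv_apply_of_isOpen [FiniteDimensional ℂ E] {f : E → ℂ} {U : Set E}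
    (hf : DifferentiableOn ℂ f U) (hU : IsOpen U) (v : E) :
    DifferentiableOn ℂ (fun x => fderiv ℂ f x v) U := by
  intro x₀ hx₀
  obtain ⟨ε, hε, hεU⟩ := Metric.isOpen_iff.1 hU x₀ hx₀
  obtain ⟨ρ, hρ, hρv⟩ : ∃ ρ : ℝ, 0 < ρ ∧ 2 * ρ * ‖v‖ < ε / 2 := by
    refine ⟨ε / (4 * (‖v‖ + 1)) / 2, by positivity, ?_⟩
    have : 0 < ‖v‖ + 1 := by positivity
    rw [div_div, mul_div_assoc', div_mul_eq_mul_div, div_lt_iff₀ (by positivity)]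
    nlinarith [norm_nonneg v]
  have hin : ∀ e ∈ ball x₀ (ε / 2), ∀ z ∈ ball (0 : ℂ) (2 * ρ), e + z • v ∈ U := by
    intro e he z hz
    refine hεU ?_
    rw [mem_ball, dist_eq_norm] at he ⊢
    rw [mem_ball_zero_iff] at hz
    have h1 : ‖z • v‖ ≤ 2 * ρ * ‖v‖ := by
      rw [norm_smul]; exact mul_le_mul_of_nonneg_right hz.le (norm_nonneg v)
    calc ‖e + z • v - x₀‖ = ‖(e - x₀) + z • v‖ := by congr 1; abel
      _ ≤ ‖e - x₀‖ + ‖z • v‖ := norm_add_le _ _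
      _ < ε := by linarith
  have hd : ∀ e ∈ ball x₀ (ε / 2), ∀ z ∈ ball (0 : ℂ) (2 * ρ),
      HasDerivAt (fun z : ℂ => f (e + z • v)) (fderiv ℂ f (e + z • v) v) z := by
    intro e he z hz
    have h1 := (hf.differentiableAt (hU.mem_nhds (hin e he z hz))).hasFDerivAt
    refine h1.comp_hasDerivAt z ?_
    simpa using ((hasDerivAt_id z).smul_const v).const_add e
  have hcauchy : ∀ e ∈ ball x₀ (ε / 2), fderiv ℂ f e v =
      (2 * Real.pi * Complex.I : ℂ)⁻¹ • ∮ z in C(0, ρ), ((z - 0) ^ 2)⁻¹ • f (e + z • v) := by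
    intro e he
    rw [Complex.two_pi_I_inv_smul_circleIntegral_sub_sq_inv_smul_of_differentiable
      (isOpen_ball (x := (0 : ℂ)) (ε := 2 * ρ)) (closedBall_subset_ball (by linarith))
      (fun z hz => (hd e he z hz).differentiableAt.differentiableWithinAt) (mem_ball_self hρ),
      (hd e he 0 (mem_ball_self (by linarith))).deriv]
    simp
  have hΩ : IsOpen {p : E × ℂ | p.2 ≠ 0 ∧ p.1 + p.2 • v ∈ U} :=
    (isOpen_ne.preimage continuous_snd).inter (hU.preimage (by fun_prop))
  have hcirc : DifferentiableOn ℂ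
      (fun e => ∮ z in C(0, ρ), ((z - 0) ^ 2)⁻¹ • f (e + z • v)) (ball x₀ (ε / 2)) := by
    refine differentiableOn_circleIntegral_param hρ.le hΩ ?_ ?_
    · rintro ⟨e, z⟩ ⟨hz, hez⟩
      have h1 : DifferentiableAt ℂ (fun p : E × ℂ => f (p.1 + p.2 • v)) (e, z) := by
        refine DifferentiableAt.comp (g := f) (f := fun p : E × ℂ => p.1 + p.2 • v) (e, z)
          (hf.differentiableAt (hU.mem_nhds hez)) (by fun_prop)
      have h2 : DifferentiableAt ℂ (fun p : E × ℂ => ((p.2 - 0) ^ 2)⁻¹) (e, z) := by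
        refine DifferentiableAt.inv (by fun_prop) ?_
        simpa using hz
      exact (h2.smul h1).differentiableWithinAt
    · rintro ⟨e, z⟩ ⟨he, hz⟩
      have hz' : ‖z‖ = ρ := by simpa using hz
      exact ⟨fun h => by rw [show z = 0 from h, norm_zero] at hz'; exact hρ.ne hz',
        hin e he z (by rw [mem_ball_zero_iff]; linarith)⟩
  have : DifferentiableAt ℂ (fun x => fderiv ℂ f x v) x₀ := by
    have hb : ball x₀ (ε / 2) ∈ 𝓝 x₀ := ball_mem_nhds _ (by linarith)
    refine ((hcirc.differentiableAt hb).const_smul (2 * Real.pi * Complex.I : ℂ)⁻¹).congr_of_eventuallyEq ?_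
    filter_upwards [hb] with e he
    exact hcauchy e he
  exact this.differentiableWithinAt

theorem DifferentiableOn.contDiffOn_of_finiteDimensional [FiniteDimensional ℂ E] {f : E → ℂ}
    {U : Set E} (hf : DifferentiableOn ℂ f U) (hU : IsOpen U) (n : ℕ) : ContDiffOn ℂ n f U := by
  induction n generalizing f with
  | zero => exact contDiffOn_zero.2 hf.continuousOn
  | succ n ih =>
    rw [Nat.cast_succ, contDiffOn_succ_iff_fderiv_of_isOpen hU]
    refine ⟨hf, by simp, ?_⟩
    rw [contDiffOn_clm_apply]
    exact fun v => ih (hf.fderiv_apply_of_isOpen hU v)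

theorem norm_iteratedFDeriv_le_of_norm_le_ball [FiniteDimensional ℂ E] {f : E → ℂ} {x : E}
    {r M δ : ℝ} (hδ : 0 < δ) (hf : DifferentiableOn ℂ f (ball x r))
    (hM : ∀ y ∈ ball x r, ‖f y‖ ≤ M) (n : ℕ) {y : E} (hy : dist y x + n * δ < r) :
    ‖iteratedFDeriv ℂ n f y‖ ≤ M * (2 / δ) ^ n := by
  induction n generalizing y with
  | zero => simpa using hM y (by simpa using hy)
  | succ n ih =>
    push_cast at hy
    have hsub : ∀ z ∈ ball y δ, dist z x + n * δ < r := by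
      intro z hz
      rw [mem_ball] at hz
      linarith [dist_triangle z y x]
    have hd : DifferentiableOn ℂ (iteratedFDeriv ℂ n f) (ball y δ) := by
      intro z hz
      have hz' : z ∈ ball x r := by
        have := hsub z hz
        have h0 : 0 ≤ n * δ := by positivity
        rw [mem_ball]; linarith
      have hc : ContDiffAt ℂ (n + 1 : ℕ) f z :=
        (hf.contDiffOn_of_finiteDimensional isOpen_ball (n + 1)).contDiffAt
          (isOpen_ball.mem_nhds hz')
      exact (hc.differentiableAt_iteratedFDeriv (by exact_mod_cast n.lt_succ_self)).differentiableWithinAt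
    rw [← norm_fderiv_iteratedFDeriv]
    refine (norm_fderiv_le_of_norm_le_ball hδ hd fun z hz => ih (hsub z hz)).trans_eq ?_
    rw [pow_succ]; ring

theorem iteratedDeriv_comp_line [FiniteDimensional ℂ E] {f : E → ℂ} {U : Set E}
    (hf : DifferentiableOn ℂ f U) (hU : IsOpen U) (x y : E) (n : ℕ) {z : ℂ} (hz : x + z • y ∈ U) :
    iteratedDeriv n (fun z : ℂ => f (x + z • y)) z =
      iteratedFDeriv ℂ n f (x + z • y) (fun _ => y) := by
  induction n generalizing z with
  | zero => simp
  | succ n ih =>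
    rw [iteratedDeriv_succ, iteratedFDeriv_succ_apply_left]
    have hev : ∀ᶠ w : ℂ in 𝓝 z, x + w • y ∈ U :=
      (by fun_prop : Continuous fun w : ℂ => x + w • y).continuousAt.eventually_mem (hU.mem_nhds hz)
    have heq : iteratedDeriv n (fun z : ℂ => f (x + z • y)) =ᶠ[𝓝 z]
        fun w => iteratedFDeriv ℂ n f (x + w • y) (fun _ => y) := by
      filter_upwards [hev] with w hw using ih hw
    rw [heq.deriv_eq]
    have hc : ContDiffAt ℂ (n + 1 : ℕ) f (x + z • y) :=
      (hf.contDiffOn_of_finiteDimensional hU (n + 1)).contDiffAt (hU.mem_nhds hz)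
    have h1 := (hc.differentiableAt_iteratedFDeriv
      (m := n) (by exact_mod_cast n.lt_succ_self)).hasFDerivAt
    have h2 : HasDerivAt (fun w : ℂ => x + w • y) y z := by
      simpa using ((hasDerivAt_id z).smul_const y).const_add x
    have h3 := h1.comp_hasDerivAt z h2
    have h4 := (ContinuousMultilinearMap.apply ℂ (fun _ : Fin n => E) ℂ (fun _ => y)).hasFDerivAt.comp_hasDerivAt z h3
    exact h4.deriv

/-- Osgood's lemma: a complex differentiable function on an open subset of a finite-dimensional
space is analytic. -/
theorem DifferentiableOn.analyticAt_of_finiteDimensional [FiniteDimensional ℂ E] {f : E → ℂ}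
    {U : Set E} (hf : DifferentiableOn ℂ f U) {x : E} (hx : U ∈ 𝓝 x) : AnalyticAt ℂ f x := by
  have : ProperSpace E := FiniteDimensional.proper ℂ E
  obtain ⟨r, hr, hrU⟩ := Metric.nhds_basis_closedBall.mem_iff.1 hx
  obtain ⟨M, hM⟩ := (isCompact_closedBall x r).exists_bound_of_continuousOn
    (hf.continuousOn.mono hrU)
  have hfr : DifferentiableOn ℂ f (ball x r) := hf.mono (ball_subset_closedBall.trans hrU)
  have hMr : ∀ y ∈ ball x r, ‖f y‖ ≤ M := fun y hy => hM y (ball_subset_closedBall hy)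
  have hM0 : 0 ≤ M := (norm_nonneg _).trans (hMr x (mem_ball_self hr))
  let p : FormalMultilinearSeries ℂ E ℂ := fun n => ((n.factorial : ℂ)⁻¹) • iteratedFDeriv ℂ n f x
  let ρ : NNReal := ⟨r / (4 * Real.exp 1), by positivity⟩
  have hρ : (ρ : ℝ) = r / (4 * Real.exp 1) := rfl
  have hρ0 : 0 < ρ := by
    rw [← NNReal.coe_pos, hρ]; positivity
  have hρr : 2 * (ρ : ℝ) < r := by
    rw [hρ, mul_div_assoc', div_lt_iff₀ (by positivity)]
    nlinarith [Real.add_one_lt_exp (x := 1) one_ne_zero]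
  have hbound : ∀ n, ‖p n‖ * (ρ : ℝ) ^ n ≤ M := by
    intro n
    rcases Nat.eq_zero_or_pos n with rfl | hn
    · simpa [p] using hMr x (mem_ball_self hr)
    have hn' : (0 : ℝ) < n := by exact_mod_cast hn
    have h1 := norm_iteratedFDeriv_le_of_norm_le_ball (δ := r / (2 * n)) (by positivity) hfr hMr n
      (y := x) (by rw [dist_self, zero_add]; field_simp; linarith)
    have h2 : (n : ℝ) ^ n / n.factorial ≤ Real.exp n := Real.pow_div_factorial_le_exp _ hn'.le n
    have hfac : (0 : ℝ) < n.factorial := by exact_mod_cast n.factorial_pos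
    have h3 : ‖p n‖ = (n.factorial : ℝ)⁻¹ * ‖iteratedFDeriv ℂ n f x‖ := by
      simp [p, norm_smul]
    rw [h3]
    calc (n.factorial : ℝ)⁻¹ * ‖iteratedFDeriv ℂ n f x‖ * (ρ : ℝ) ^ n
        ≤ (n.factorial : ℝ)⁻¹ * (M * (2 / (r / (2 * n))) ^ n) * (ρ : ℝ) ^ n := by gcongr
      _ = M * ((n : ℝ) ^ n / n.factorial) * ((4 / r) * ρ) ^ n := by
          rw [show 2 / (r / (2 * n)) = n * (4 / r) by field_simp; ring, mul_pow, mul_pow]; ring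
      _ ≤ M * Real.exp n * ((4 / r) * ρ) ^ n := by gcongr
      _ = M * (Real.exp 1 * ((4 / r) * ρ)) ^ n := by
          rw [← Real.exp_one_pow n, mul_pow]; ring
      _ = M := by
          rw [hρ, show Real.exp 1 * (4 / r * (r / (4 * Real.exp 1))) = 1 by field_simp]; simp
  refine ⟨p, ρ, ?_, by exact_mod_cast hρ0, ?_⟩
  · exact p.le_radius_of_bound M hbound
  · intro y hy
    have hy' : ‖y‖ < ρ := by
      simpa [Metric.mem_eball, edist_zero_right, enorm_eq_nnnorm] using hy
    have hin : ∀ z ∈ ball (0 : ℂ) 2, x + z • y ∈ ball x r := by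
      intro z hz
      rw [mem_ball_zero_iff] at hz
      rw [mem_ball, dist_self_add_left, norm_smul]
      nlinarith [norm_nonneg y, norm_nonneg z]
    have hd : DifferentiableOn ℂ (fun z : ℂ => f (x + z • y)) (ball 0 2) := by
      intro z hz
      exact (DifferentiableAt.comp (g := f) (f := fun z : ℂ => x + z • y) z
        (hfr.differentiableAt (isOpen_ball.mem_nhds (hin z hz))) (by fun_prop)).differentiableWithinAt
    have h1 := Complex.hasSum_taylorSeries_on_ball (z := (1 : ℂ)) hd
      (by rw [mem_ball_zero_iff]; norm_num)
    convert h1 using 2 with n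
    · rw [iteratedDeriv_comp_line hfr isOpen_ball x y n
        (by simpa using hr)]
      simp [p]
    · simp

end Holomorphic

section Removable

open Metric Set Filter Topology

theorem eqOn_prod_ball_of_eq_off_zero {X : Type*} [TopologicalSpace X] {h₁ h₂ : X × ℂ → ℂ} {V : Set X}
    {R : ℝ} (hV : IsOpen V) (h₁c : ContinuousOn h₁ (V ×ˢ ball 0 R)) (h₂c : ContinuousOn h₂ (V ×ˢ ball 0 R))
    (h : ∀ p ∈ V ×ˢ ball (0 : ℂ) R, p.2 ≠ 0 → h₁ p = h₂ p) :
    ∀ p ∈ V ×ˢ ball (0 : ℂ) R, h₁ p = h₂ p := by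
  rintro ⟨t, z⟩ hp
  by_cases hz : z = 0
  · subst hz
    have hP : V ×ˢ ball (0 : ℂ) R ∈ 𝓝 (t, (0 : ℂ)) := (hV.prod isOpen_ball).mem_nhds hp
    have hl : Tendsto (fun z : ℂ => (t, z)) (𝓝[≠] 0) (𝓝 (t, 0)) :=
      (by fun_prop : Continuous fun z : ℂ => (t, z)).continuousAt.tendsto.mono_left
        nhdsWithin_le_nhds
    have l₁ := (h₁c.continuousAt hP).tendsto.comp hl
    have l₂ := (h₂c.continuousAt hP).tendsto.comp hl
    refine tendsto_nhds_unique l₁ (l₂.congr' ?_)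
    filter_upwards [hl.eventually hP, self_mem_nhdsWithin] with z hz hz0
    exact (h (t, z) hz hz0).symm
  · exact h _ hp hz

variable {E : Type*} [NormedAddCommGroup E] [NormedSpace ℂ E]

/-- Riemann's extension theorem across a smooth hypersurface `{z = 0}`. -/
theorem exists_analytic_extension_prod_ball [FiniteDimensional ℂ E] {f : E × ℂ → ℂ} {V : Set E}
    {R : ℝ} (hV : IsOpen V) (hR : 0 < R)
    (hf : DifferentiableOn ℂ f (V ×ˢ (ball 0 R \ {0})))
    (hb : ∀ t ∈ V, IsBoundedUnder (· ≤ ·) (𝓝[≠] 0) fun z => ‖f (t, z) - f (t, 0)‖) :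
    ∃ g : E × ℂ → ℂ, AnalyticOnNhd ℂ g (V ×ˢ ball 0 R) ∧
      ∀ p ∈ V ×ˢ ball (0 : ℂ) R, p.2 ≠ 0 → g p = f p := by
  have hopen : IsOpen (V ×ˢ (ball (0 : ℂ) R \ {0})) :=
    hV.prod (isOpen_ball.sdiff isClosed_singleton)
  set g₀ : E × ℂ → ℂ := fun p =>
    (2 * Real.pi * Complex.I : ℂ)⁻¹ • ∮ z in C(0, R / 2), (z - p.2)⁻¹ • f (p.1, z) with hg₀
  have hg₀d : DifferentiableOn ℂ g₀ (V ×ˢ ball 0 (R / 2)) := by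
    suffices hI : DifferentiableOn ℂ
        (fun p : E × ℂ => ∮ z in C(0, R / 2), (z - p.2)⁻¹ • f (p.1, z)) (V ×ˢ ball 0 (R / 2)) from
      fun p hp => (hI p hp).const_smul (2 * Real.pi * Complex.I : ℂ)⁻¹
    have hΩ : IsOpen {q : (E × ℂ) × ℂ | q.2 ≠ q.1.2 ∧ (q.1.1, q.2) ∈ V ×ˢ (ball (0 : ℂ) R \ {0})} :=
      (isOpen_ne_fun (by fun_prop) (by fun_prop)).inter (hopen.preimage (by fun_prop))
    refine differentiableOn_circleIntegral_param (by positivity) hΩ ?_ ?_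
    · rintro ⟨⟨t, u⟩, z⟩ ⟨hzu, hmem⟩
      have h1 : DifferentiableAt ℂ (fun q : (E × ℂ) × ℂ => f (q.1.1, q.2)) ((t, u), z) :=
        DifferentiableAt.comp (g := f) (f := fun q : (E × ℂ) × ℂ => (q.1.1, q.2)) ((t, u), z)
          (hf.differentiableAt (hopen.mem_nhds hmem)) (by fun_prop)
      have h2 : DifferentiableAt ℂ (fun q : (E × ℂ) × ℂ => (q.2 - q.1.2)⁻¹) ((t, u), z) :=
        DifferentiableAt.inv (by fun_prop) (sub_ne_zero.2 hzu)
      exact (h2.smul h1).differentiableWithinAt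
    · rintro ⟨⟨t, u⟩, z⟩ ⟨⟨ht, hu⟩, hz⟩
      have hz' : ‖z‖ = R / 2 := by simpa using hz
      have hu' : ‖u‖ < R / 2 := by simpa using hu
      refine ⟨fun h => ?_, ht, ?_, fun h => ?_⟩
      · rw [show z = u from h] at hz'; linarith
      · rw [mem_ball_zero_iff]; linarith
      · rw [show z = 0 from h, norm_zero] at hz'; linarith
  have hg₀f : ∀ p ∈ V ×ˢ ball (0 : ℂ) (R / 2), p.2 ≠ 0 → g₀ p = f p := by
    rintro ⟨t, u⟩ ⟨ht, hu⟩ hu0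
    have hd : DifferentiableOn ℂ (fun z => f (t, z)) (ball 0 R \ {0}) := by
      intro z hz
      exact (DifferentiableAt.comp (g := f) (f := fun z : ℂ => (t, z)) z
        (hf.differentiableAt (hopen.mem_nhds ⟨ht, hz⟩)) (by fun_prop)).differentiableWithinAt
    have hext := Complex.differentiableOn_update_limUnder_of_isLittleO (ball_mem_nhds 0 hR) hd
      (hb t ht).isLittleO_sub_self_inv
    have hcl : closedBall (0 : ℂ) (R / 2) ⊆ ball 0 R := closedBall_subset_ball (by linarith)
    have hcauchy := (hext.mono hcl).circleIntegral_sub_inv_smul hu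
    have hcongr : (∮ z in C(0, R / 2), (z - u)⁻¹ • f (t, z)) =
        ∮ z in C(0, R / 2), (z - u)⁻¹ •
          Function.update (fun z => f (t, z)) 0 (limUnder (𝓝[≠] 0) fun z => f (t, z)) z := by
      refine circleIntegral.integral_congr (by positivity) fun z hz => ?_
      have hz0 : z ≠ 0 := by
        rintro rfl
        simp at hz; linarith
      simp [Function.update_of_ne hz0]
    have hne : (2 * Real.pi * Complex.I : ℂ) ≠ 0 := Complex.two_pi_I_ne_zero
    simp only [hg₀]
    rw [hcongr, hcauchy, Function.update_of_ne hu0, smul_smul, inv_mul_cancel₀ hne, one_smul]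
  refine ⟨fun p => if p.2 = 0 then g₀ p else f p, ?_, fun p _ hp => if_neg hp⟩
  rintro ⟨t, z⟩ ⟨ht, hz⟩
  by_cases hz0 : z = 0
  · subst hz0
    have hmem : V ×ˢ ball (0 : ℂ) (R / 2) ∈ 𝓝 (t, (0 : ℂ)) :=
      (hV.prod isOpen_ball).mem_nhds ⟨ht, mem_ball_self (by linarith)⟩
    refine (hg₀d.analyticAt_of_finiteDimensional hmem).congr ?_
    filter_upwards [hmem] with p hp
    split_ifs with h
    · rfl
    · exact hg₀f p hp h
  · have hmem : V ×ˢ (ball (0 : ℂ) R \ {0}) ∈ 𝓝 (t, z) := hopen.mem_nhds ⟨ht, hz, hz0⟩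
    refine (hf.analyticAt_of_finiteDimensional hmem).congr ?_
    filter_upwards [hmem] with p hp
    exact (if_neg (show ¬ p.2 = 0 from hp.2.2)).symm

theorem exists_analytic_eq_snd_mul [FiniteDimensional ℂ E] {f : E × ℂ → ℂ} {V : Set E}
    {R : ℝ} (hV : IsOpen V) (hR : 0 < R) (hf : AnalyticOnNhd ℂ f (V ×ˢ ball 0 R))
    (h0 : ∀ t ∈ V, f (t, 0) = 0) :
    ∃ g : E × ℂ → ℂ, AnalyticOnNhd ℂ g (V ×ˢ ball 0 R) ∧
      ∀ p ∈ V ×ˢ ball (0 : ℂ) R, f p = p.2 * g p := by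
  have hdiff : DifferentiableOn ℂ (fun p => f p / p.2) (V ×ˢ (ball 0 R \ {0})) := by
    rintro ⟨t, z⟩ ⟨ht, hz, hz0⟩
    have hinv : DifferentiableAt ℂ (fun p : E × ℂ => p.2⁻¹) (t, z) :=
      DifferentiableAt.inv (by fun_prop) hz0
    simp only [div_eq_mul_inv]
    exact ((hf (t, z) ⟨ht, hz⟩).differentiableAt.mul hinv).differentiableWithinAt
  have hbdd : ∀ t ∈ V, IsBoundedUnder (· ≤ ·) (𝓝[≠] 0)
      fun z : ℂ => ‖f (t, z) / z - f (t, 0) / 0‖ := by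
    intro t ht
    have hd : DifferentiableAt ℂ (fun z => f (t, z)) 0 :=
      DifferentiableAt.comp (g := f) (f := fun z : ℂ => (t, z)) 0
        (hf (t, 0) ⟨ht, mem_ball_self hR⟩).differentiableAt (by fun_prop)
    have h1 := hd.hasDerivAt.tendsto_slope.norm.isBoundedUnder_le
    have he : (fun z : ℂ => ‖f (t, z) / z - f (t, 0) / 0‖) =
        fun z => ‖slope (fun z => f (t, z)) 0 z‖ := by
      funext z
      simp [slope, h0 t ht, div_eq_inv_mul]
    rw [he]
    exact h1
  obtain ⟨g, hg, hgf⟩ := exists_analytic_extension_prod_ball hV hR hdiff hbdd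
  refine ⟨g, hg, ?_⟩
  rintro ⟨t, z⟩ hp
  by_cases hz : z = 0
  · subst hz
    simp [h0 t hp.1]
  · rw [hgf _ hp hz]
    field_simp

theorem exists_eq_pow_mul_unit_of_mul_eq [FiniteDimensional ℂ E] {V : Set E} {R : ℝ}
    (hV : IsOpen V) (hVc : IsPreconnected V) (hR : 0 < R) (m : ℕ) {f₁ f₂ w : E × ℂ → ℂ}
    (h₁ : AnalyticOnNhd ℂ f₁ (V ×ˢ ball 0 R)) (h₂ : AnalyticOnNhd ℂ f₂ (V ×ˢ ball 0 R))
    (hw : AnalyticOnNhd ℂ w (V ×ˢ ball 0 R)) (hw0 : ∀ p ∈ V ×ˢ ball (0 : ℂ) R, w p ≠ 0)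
    (h : ∀ p ∈ V ×ˢ ball (0 : ℂ) R, f₁ p * f₂ p = p.2 ^ m * w p) :
    ∃ (k : ℕ) (v : E × ℂ → ℂ), AnalyticOnNhd ℂ v (V ×ˢ ball 0 R) ∧
      (∀ p ∈ V ×ˢ ball (0 : ℂ) R, v p ≠ 0) ∧
      ∀ p ∈ V ×ˢ ball (0 : ℂ) R, f₁ p = p.2 ^ k * v p := by
  induction m generalizing f₁ f₂ with
  | zero =>
    refine ⟨0, f₁, h₁, fun p hp h0 => hw0 p hp ?_, fun p _ => by simp⟩
    simpa [h0] using (h p hp).symm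
  | succ m ih =>
    have hslice : ∀ {f : E × ℂ → ℂ}, AnalyticOnNhd ℂ f (V ×ˢ ball 0 R) →
        AnalyticOnNhd ℂ (fun t => f (t, 0)) V := fun hf t ht =>
      (hf (t, 0) ⟨ht, mem_ball_self hR⟩).fun_comp (f := fun t : E => (t, (0 : ℂ)))
        (analyticAt_id.prod analyticAt_const)
    have hcancel : ∀ {g₁ g₂ : E × ℂ → ℂ}, AnalyticOnNhd ℂ g₁ (V ×ˢ ball 0 R) →
        AnalyticOnNhd ℂ g₂ (V ×ˢ ball 0 R) →
        (∀ p ∈ V ×ˢ ball (0 : ℂ) R, p.2 * (g₁ p * g₂ p) = p.2 ^ (m + 1) * w p) →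
        ∀ p ∈ V ×ˢ ball (0 : ℂ) R, g₁ p * g₂ p = p.2 ^ m * w p := by
      intro g₁ g₂ hg₁ hg₂ hg
      refine eqOn_prod_ball_of_eq_off_zero hV (hg₁.continuousOn.mul hg₂.continuousOn)
        (ContinuousOn.mul (by fun_prop) hw.continuousOn) fun p hp hp0 => ?_
      refine mul_left_cancel₀ hp0 ?_
      rw [hg p hp]; ring
    have hdich : (∀ t ∈ V, f₁ (t, 0) = 0) ∨ (∀ t ∈ V, f₂ (t, 0) = 0) := by
      by_contra! hcon
      obtain ⟨⟨t₀, ht₀, hne⟩, t₁, ht₁, hne₁⟩ := hcon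
      refine hne₁ ((hslice h₂).eqOn_zero_of_preconnected_of_eventuallyEq_zero hVc ht₀ ?_ ht₁)
      filter_upwards [((hslice h₁) t₀ ht₀).continuousAt.eventually_ne hne, hV.mem_nhds ht₀]
        with t ht htV
      have := h (t, 0) ⟨htV, mem_ball_self hR⟩
      simpa [ht] using this
    rcases hdich with h0 | h0
    · obtain ⟨g, hg, hfg⟩ := exists_analytic_eq_snd_mul hV hR h₁ h0
      obtain ⟨k, v, hv, hv0, hgv⟩ := ih hg h₂ (hcancel hg h₂ fun p hp => by
        rw [← h p hp, hfg p hp]; ring)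
      exact ⟨k + 1, v, hv, hv0, fun p hp => by rw [hfg p hp, hgv p hp]; ring⟩
    · obtain ⟨g, hg, hfg⟩ := exists_analytic_eq_snd_mul hV hR h₂ h0
      exact ih h₁ hg (hcancel h₁ hg fun p hp => by rw [← h p hp, hfg p hp]; ring)

end Removable

section Discriminant

theorem degree_sum_lt_mkPoly (d : ℕ) (a : Fin d → ℂ) :
    (∑ i : Fin d, C (a i) * X ^ (d - (i.val + 1)) : ℂ[X]).degree < d := by
  refine (Polynomial.degree_sum_le _ _).trans_lt ?_
  refine (Finset.sup_lt_iff (WithBot.bot_lt_coe d)).2 fun i _ => ?_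
  refine (Polynomial.degree_C_mul_X_pow_le _ _).trans_lt ?_
  have := i.isLt
  exact Nat.cast_lt.2 (by omega : d - (i.val + 1) < d)

theorem exists_mkPoly_eq_prod (d : ℕ) (a : Fin d → ℂ) :
    ∃ ξ : Fin d → ℂ, mkPoly d a = ∏ i, (X - C (ξ i)) := by
  have hs := IsAlgClosed.splits (mkPoly d a)
  have hlen : (mkPoly d a).roots.toList.length = d := by
    rw [Multiset.length_toList, ← hs.natDegree_eq_card_roots, natDegree_mkPoly]
  refine ⟨fun i => (mkPoly d a).roots.toList.get (i.cast hlen.symm), ?_⟩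
  conv_lhs => rw [hs.eq_prod_roots_of_monic (monic_mkPoly d a), ← Multiset.coe_toList (mkPoly d a).roots]
  rw [Multiset.map_coe, Multiset.prod_coe, ← List.prod_ofFn]
  congr 1
  refine List.ext_getElem (by simpa using hlen) fun n h₁ h₂ => by simp

theorem prod_sub_sq_comp_perm {n : ℕ} (ξ : Fin n → ℂ) (σ : Equiv.Perm (Fin n)) :
    ∏ i, ∏ j ∈ Ioi i, (ξ (σ j) - ξ (σ i)) ^ 2 = ∏ i, ∏ j ∈ Ioi i, (ξ j - ξ i) ^ 2 := by
  have key : ∀ η : Fin n → ℂ, ∏ i, ∏ j ∈ Ioi i, (η j - η i) ^ 2 =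
      (Matrix.vandermonde η).det ^ 2 := fun η => by
    simp only [Matrix.det_vandermonde, Finset.prod_pow]
  have hperm : Matrix.vandermonde (fun i => ξ (σ i)) = (Matrix.vandermonde ξ).submatrix σ id := rfl
  rw [key fun i => ξ (σ i), key, hperm, Matrix.det_permute, mul_pow]
  have : ((Equiv.Perm.sign σ : ℤ) : ℂ) ^ 2 = 1 := by
    rcases Int.units_eq_one_or (Equiv.Perm.sign σ) with h | h <;> simp [h]
  rw [this, one_mul]

theorem exists_perm_of_map_univ_eq {ι α : Type*} [Fintype ι] {f g : ι → α}
    (h : (univ : Finset ι).val.map f = (univ : Finset ι).val.map g) :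
    ∃ σ : Equiv.Perm ι, ∀ i, f i = g (σ i) := by
  classical
  have hcard : ∀ c, Fintype.card {i // f i = c} = Fintype.card {i // g i = c} := fun c => by
    have := congrArg (Multiset.count c) h
    rw [Multiset.count_map, Multiset.count_map] at this
    rw [Fintype.card_subtype, Fintype.card_subtype]
    simpa only [eq_comm, Finset.card, Finset.filter_val] using this
  exact ⟨Equiv.ofFiberEquiv fun c => Fintype.equivOfCardEq (hcard c),
    fun i => (Equiv.ofFiberEquiv_map _ i).symm⟩

theorem polyDisc_prod_X_sub_C {n : ℕ} (ξ : Fin n → ℂ) :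
    polyDisc (∏ i, (X - C (ξ i))) = ∏ i, ∏ j ∈ Ioi i, (ξ j - ξ i) ^ 2 := by
  have hr : (∏ i, (X - C (ξ i))).roots = univ.val.map ξ := by
    rw [← Polynomial.roots_multiset_prod_X_sub_C (univ.val.map ξ), Multiset.map_map]
    rfl
  have hlen : (∏ i, (X - C (ξ i))).roots.toList.length = n := by
    rw [Multiset.length_toList, hr]; simp
  unfold polyDisc
  have hcoe := Multiset.coe_toList (∏ i, (X - C (ξ i))).roots
  generalize (∏ i, (X - C (ξ i))).roots.toList = L at hlen hcoe ⊢
  subst hlen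
  have hmap : univ.val.map (fun i : Fin L.length => L.getD i 0) = univ.val.map ξ := by
    rw [← hr, ← hcoe]
    simp [Fin.univ_val_map, List.ofFn_getElem]
  obtain ⟨σ, hσ⟩ := exists_perm_of_map_univ_eq hmap
  have hσ' : ∀ i : Fin L.length, L.getD i 0 = ξ (σ i) := hσ
  rw [← prod_sub_sq_comp_perm ξ σ, Finset.prod_sigma']
  refine (Finset.prod_bij' (fun x _ => (x.1.val, x.2.val))
    (fun q hq => ⟨⟨q.1, by simp at hq; omega⟩, ⟨q.2, by simp at hq; omega⟩⟩) ?_ ?_ ?_ ?_ ?_).symm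
  · rintro ⟨i, j⟩ h
    simpa using h
  · rintro ⟨i, j⟩ h
    simp at h
    simpa using h.2
  · rintro ⟨i, j⟩ h
    rfl
  · rintro ⟨i, j⟩ h
    rfl
  · rintro ⟨i, j⟩ h
    simp only [← hσ']

theorem polyDisc_prod_X_sub_C_ne_zero_iff {n : ℕ} (ξ : Fin n → ℂ) :
    polyDisc (∏ i, (X - C (ξ i))) ≠ 0 ↔ Function.Injective ξ := by
  rw [polyDisc_prod_X_sub_C, ← Matrix.det_vandermonde_ne_zero_iff, Matrix.det_vandermonde]
  simp only [Finset.prod_pow]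
  simp

theorem eval_prod_X_sub_C_eq_zero_iff {n : ℕ} (ξ : Fin n → ℂ) (y : ℂ) :
    (∏ i, (X - C (ξ i))).eval y = 0 ↔ ∃ i, y = ξ i := by
  simp [Polynomial.eval_prod, Finset.prod_eq_zero_iff, sub_eq_zero]

theorem prod_X_sub_C_eq_of_injective {n : ℕ} {ξ η : Fin n → ℂ} (hη : Function.Injective η)
    (h : ∀ i, (∏ i, (X - C (ξ i))).eval (η i) = 0) :
    ∏ i, (X - C (ξ i)) = ∏ i, (X - C (η i)) := by
  choose σ hσ using fun i => (eval_prod_X_sub_C_eq_zero_iff ξ _).1 (h i)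
  have hinj : Function.Injective σ := fun i j hij => hη (by rw [hσ, hσ, hij])
  have hbij := Finite.injective_iff_bijective.1 hinj
  rw [← Function.Bijective.prod_comp hbij]
  simp only [← hσ]

end Discriminant

section Roots

open Metric Set Filter Topology

theorem isCoveringMap_of_local_sections {Z S : Type*} [TopologicalSpace Z] [TopologicalSpace S]
    [T2Space Z] {n : ℕ} {p : Z → S} (hp : Continuous p)
    (h : ∀ s, ∃ U : Set S, IsOpen U ∧ s ∈ U ∧ ∃ r : Fin n → S → Z, (∀ i, ContinuousOn (r i) U) ∧
      (∀ s ∈ U, ∀ i, p (r i s) = s) ∧ (∀ s ∈ U, Function.Injective fun i => r i s) ∧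
      ∀ z, p z ∈ U → ∃ i, r i (p z) = z) :
    IsCoveringMap p := by
  intro s
  obtain ⟨U, hU, hsU, r, hrc, hrp, hri, hrs⟩ := h s
  choose idx hidx using fun z : p ⁻¹' U => hrs z z.2
  have hsec : ∀ i, Continuous fun z : p ⁻¹' U => r i (p z) := fun i =>
    (hrc i).comp_continuous (by fun_prop) fun z => z.2
  have hidx_iff : ∀ z i, idx z = i ↔ r i (p z) = z := fun z i =>
    ⟨fun h => h ▸ hidx z, fun h => hri _ z.2 ((hidx z).trans h.symm)⟩
  have hidxc : Continuous idx := by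
    refine continuous_discrete_rng.2 fun i => ?_
    have : idx ⁻¹' {i} = (⋃ j ∈ {j | j ≠ i}, {z : p ⁻¹' U | r j (p z) = z})ᶜ := by
      ext z
      simp only [Set.mem_preimage, mem_singleton_iff, mem_compl_iff, mem_iUnion, mem_ofPred_eq,
        exists_prop, not_exists, not_and, ← hidx_iff]
      exact ⟨fun h j hj hz => hj (hz.symm.trans h), fun h => by_contra fun hne => h _ hne rfl⟩
    rw [this, isOpen_compl_iff]
    exact (Set.toFinite _).isClosed_biUnion fun j _ =>
      isClosed_eq (hsec j) continuous_subtype_val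
  refine IsEvenlyCovered.to_isEvenlyCovered_preimage (I := Fin n)
    ⟨inferInstance, U, hsU, hU, hU.preimage hp, ?_, ?_⟩
  · exact
    { toFun := fun z => (⟨p z, z.2⟩, idx z)
      invFun := fun q => ⟨r q.2 q.1, by simp [hrp _ q.1.2]⟩
      left_inv := fun z => Subtype.ext (hidx z)
      right_inv := fun q => by
        refine Prod.ext (Subtype.ext (hrp _ q.1.2 _)) ?_
        rw [hidx_iff]
        simp only [hrp _ q.1.2]
      continuous_toFun := by fun_prop
      continuous_invFun := by
        refine continuous_prod_of_discrete_right.2 fun i => ?_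
        exact ((hrc i).comp_continuous continuous_subtype_val fun s => s.2).subtype_mk _ }
  · intro z
    rfl

theorem exists_local_root {E : Type*} [NormedAddCommGroup E] [NormedSpace ℂ E] [CompleteSpace E]
    {G : E × ℂ → ℂ} {s₀ : E} {y₀ : ℂ} (hG : AnalyticAt ℂ G (s₀, y₀)) (h0 : G (s₀, y₀) = 0)
    (hder : deriv (fun y => G (s₀, y)) y₀ ≠ 0) :
    ∃ ψ : E → ℂ, ψ s₀ = y₀ ∧ DifferentiableAt ℂ ψ s₀ ∧ (∀ᶠ s in 𝓝 s₀, ContinuousAt ψ s) ∧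
      ∀ᶠ v in 𝓝 (s₀, y₀), G v = 0 ↔ ψ v.1 = v.2 := by
  have cdf : ContDiffAt ℂ 1 G (s₀, y₀) := hG.contDiffAt
  have hL : (fderiv ℂ G (s₀, y₀) ∘L .inr ℂ E ℂ) 1 ≠ 0 := by
    have h1 : HasDerivAt (fun y : ℂ => (s₀, y)) ((0 : E), (1 : ℂ)) y₀ :=
      (hasDerivAt_const y₀ s₀).prodMk (hasDerivAt_id y₀)
    have h2 := hG.differentiableAt.hasFDerivAt.comp_hasDerivAt y₀ h1
    have h3 : deriv (fun y => G (s₀, y)) y₀ = fderiv ℂ G (s₀, y₀) (0, 1) := h2.deriv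
    rw [h3] at hder
    simpa using hder
  have hinv : (fderiv ℂ G (s₀, y₀) ∘L .inr ℂ E ℂ).IsInvertible := by
    generalize (fderiv ℂ G (s₀, y₀) ∘L .inr ℂ E ℂ) = L at hL
    refine ContinuousLinearMap.IsInvertible.of_inverse (g := (L 1)⁻¹ • ContinuousLinearMap.id ℂ ℂ)
      ?_ ?_
    · ext
      simp [hL]
    · ext
      simp [hL]
  refine ⟨cdf.implicitFunction one_ne_zero hinv, cdf.implicitFunction_apply_self one_ne_zero hinv,
    (cdf.contDiffAt_implicitFunction one_ne_zero hinv).differentiableAt one_ne_zero, ?_, ?_⟩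
  · filter_upwards [(cdf.contDiffAt_implicitFunction one_ne_zero hinv).eventually (by simp)]
      with s hs using hs.continuousAt
  · simpa [h0] using cdf.eventually_apply_eq_iff_implicitFunction one_ne_zero hinv

variable {E : Type*} [NormedAddCommGroup E] [NormedSpace ℂ E] [CompleteSpace E] {d : ℕ}
  {c : Fin d → E → ℂ}

theorem exists_local_root_mkPoly {s₀ : E} (hc : ∀ i, AnalyticAt ℂ (c i) s₀)
    (hdisc : polyDisc (mkPoly d fun i => c i s₀) ≠ 0) {y₀ : ℂ}
    (hy₀ : (mkPoly d fun i => c i s₀).eval y₀ = 0) :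
    ∃ ψ : E → ℂ, ψ s₀ = y₀ ∧ DifferentiableAt ℂ ψ s₀ ∧ (∀ᶠ s in 𝓝 s₀, ContinuousAt ψ s) ∧
      ∀ᶠ v in 𝓝 (s₀, y₀), (mkPoly d fun i => c i v.1).eval v.2 = 0 ↔ ψ v.1 = v.2 := by
  refine exists_local_root (G := fun v => (mkPoly d fun i => c i v.1).eval v.2) ?_ hy₀ ?_
  · simp only [eval_mkPoly]
    have hc' : ∀ i, AnalyticAt ℂ (fun v : E × ℂ => c i v.1) (s₀, y₀) := fun i =>
      AnalyticAt.fun_comp (g := c i) (f := Prod.fst) (x := (s₀, y₀)) (hc i) analyticAt_fst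
    exact (analyticAt_snd.pow d).add (Finset.analyticAt_fun_sum _ fun i _ =>
      (hc' i).mul (analyticAt_snd.pow _))
  · simp only [Polynomial.deriv]
    obtain ⟨ξ, hξ⟩ := exists_mkPoly_eq_prod d fun i => c i s₀
    have hsep : (mkPoly d fun i => c i s₀).Separable := by
      rw [hξ, Polynomial.separable_prod_X_sub_C_iff, ← polyDisc_prod_X_sub_C_ne_zero_iff, ← hξ]
      exact hdisc
    simpa using hsep.aeval_derivative_ne_zero (x := y₀) (by simpa using hy₀)

theorem isCoveringMap_roots_mkPoly {S : Set E}
    (hc : ∀ i, AnalyticOnNhd ℂ (c i) S)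
    (hdisc : ∀ s ∈ S, polyDisc (mkPoly d fun i => c i s) ≠ 0) :
    IsCoveringMap fun z : {z : S × ℂ // (mkPoly d fun i => c i z.1).eval z.2 = 0} => z.1.1 := by
  refine isCoveringMap_of_local_sections (n := d) (by fun_prop) fun s₀ => ?_
  obtain ⟨ξ, hξ⟩ := exists_mkPoly_eq_prod d fun i => c i s₀
  have hξinj : Function.Injective ξ := by
    rw [← polyDisc_prod_X_sub_C_ne_zero_iff, ← hξ]
    exact hdisc s₀ s₀.2
  have hroot : ∀ i, (mkPoly d fun i => c i s₀).eval (ξ i) = 0 := fun i => by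
    rw [hξ]
    exact (eval_prod_X_sub_C_eq_zero_iff ξ _).2 ⟨i, rfl⟩
  choose ψ hψ₀ hψd hψc hψr using fun i =>
    exists_local_root_mkPoly (fun i => hc i s₀ s₀.2) (hdisc s₀ s₀.2) (hroot i)
  have hψr' : ∀ i, ∀ᶠ s in 𝓝 (s₀ : E), (mkPoly d fun i => c i s).eval (ψ i s) = 0 := fun i => by
    have ht : Tendsto (fun s => (s, ψ i s)) (𝓝 (s₀ : E)) (𝓝 ((s₀ : E), ξ i)) := by
      have := (hψd i).continuousAt.tendsto
      rw [hψ₀] at this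
      exact tendsto_id.prodMk_nhds this
    filter_upwards [ht.eventually (hψr i)] with s hs using hs.2 rfl
  have hψi : ∀ᶠ s in 𝓝 (s₀ : E), Function.Injective fun i => ψ i s := by
    have : ∀ i j, i ≠ j → ∀ᶠ s in 𝓝 (s₀ : E), ψ i s ≠ ψ j s := fun i j hij =>
      (hψd i).continuousAt.ne_iff_eventually_ne (hψd j).continuousAt |>.1
        (by rw [hψ₀, hψ₀]; exact hξinj.ne hij)
    have h' : ∀ᶠ s in 𝓝 (s₀ : E), ∀ i j, i ≠ j → ψ i s ≠ ψ j s := by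
      simp only [eventually_all]
      exact this
    filter_upwards [h'] with s hs i j hij using by_contra fun hne => hs i j hne hij
  obtain ⟨U, hU, hUo, hsU⟩ := _root_.eventually_nhds_iff.1
    ((eventually_all.2 hψc).and ((eventually_all.2 hψr').and hψi))
  classical
  refine ⟨Subtype.val ⁻¹' U, hUo.preimage continuous_subtype_val, hsU, fun i s =>
    if hs : (mkPoly d fun i => c i s).eval (ψ i s) = 0 then ⟨(s, ψ i s), hs⟩
    else ⟨(s₀, ξ i), hroot i⟩, fun i => ?_, fun s hs i => ?_, fun s hs i j hij => ?_, fun z hz => ?_⟩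
  · rw [continuousOn_iff_continuous_domRestrict, continuous_induced_rng]
    have : Continuous fun s : (Subtype.val ⁻¹' U : Set S) => ((s : S), ψ i s) :=
      Continuous.prodMk continuous_subtype_val <| continuous_iff_continuousAt.2 fun s =>
        ContinuousAt.comp (f := fun s : (Subtype.val ⁻¹' U : Set S) => ((s : S) : E)) (g := ψ i)
          ((hU _ s.2).1 i) (by fun_prop)
    refine this.congr fun s => ?_
    simp only [Function.comp_apply, Set.domRestrict_apply]
    rw [dif_pos ((hU _ s.2).2.1 i)]
  · dsimp only
    rw [dif_pos ((hU _ hs).2.1 i)]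
  · simp only at hij
    rw [dif_pos ((hU _ hs).2.1 i), dif_pos ((hU _ hs).2.1 j)] at hij
    exact (hU _ hs).2.2 (congrArg (fun z => z.1.2) hij)
  · obtain ⟨⟨s, y⟩, hy⟩ := z
    obtain ⟨η, hη⟩ := exists_mkPoly_eq_prod d fun i => c i s
    have heq := prod_X_sub_C_eq_of_injective (ξ := η) (hU _ hz).2.2 fun i => by
      rw [← hη]
      exact (hU _ hz).2.1 i
    obtain ⟨i, hi⟩ := (eval_prod_X_sub_C_eq_zero_iff _ y).1 (by rw [← heq, ← hη]; exact hy)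
    refine ⟨i, ?_⟩
    dsimp only
    rw [dif_pos ((hU _ hz).2.1 i)]
    exact Subtype.ext (Prod.ext rfl hi.symm)

/-- The roots of a monic polynomial with analytic coefficients and nonvanishing discriminant over
a simply connected open set are given by global holomorphic functions. -/
theorem exists_global_roots_mkPoly {S : Set E} (hSo : IsOpen S) (hSne : S.Nonempty)
    [SimplyConnectedSpace S] [LocallyPathConnectedSpace S]
    (hc : ∀ i, AnalyticOnNhd ℂ (c i) S)
    (hdisc : ∀ s ∈ S, polyDisc (mkPoly d fun i => c i s) ≠ 0) :
    ∃ φ : Fin d → E → ℂ, (∀ i, DifferentiableOn ℂ (φ i) S) ∧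
      (∀ s ∈ S, (mkPoly d fun i => c i s) = ∏ i, (X - C (φ i s))) ∧
      (∀ s ∈ S, Function.Injective fun i => φ i s) ∧
      ∀ ψ : E → ℂ, ContinuousOn ψ S → (∀ s ∈ S, (mkPoly d fun i => c i s).eval (ψ s) = 0) →
        ∃ i, ∀ s ∈ S, ψ s = φ i s := by
  have cov := isCoveringMap_roots_mkPoly hc hdisc
  obtain ⟨s₀, hs₀⟩ := hSne
  obtain ⟨ξ, hξ⟩ := exists_mkPoly_eq_prod d fun i => c i s₀
  have hξinj : Function.Injective ξ := by
    rw [← polyDisc_prod_X_sub_C_ne_zero_iff, ← hξ]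
    exact hdisc s₀ hs₀
  have hroot : ∀ i, (mkPoly d fun i => c i s₀).eval (ξ i) = 0 := fun i => by
    rw [hξ]
    exact (eval_prod_X_sub_C_eq_zero_iff ξ _).2 ⟨i, rfl⟩
  choose Φ hΦ using fun i => (cov.existsUnique_continuousMap_lifts (ContinuousMap.id S) ⟨s₀, hs₀⟩
    ⟨(⟨s₀, hs₀⟩, ξ i), hroot i⟩ rfl).exists
  have hΦfst : ∀ i s, (Φ i s).1.1 = s := fun i s => congrFun (hΦ i).2 s
  have hΦroot : ∀ i (s : S), (mkPoly d fun i => c i s).eval (Φ i s).1.2 = 0 := fun i s => by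
    have := (Φ i s).2
    rwa [hΦfst] at this
  have hΦinj : ∀ s : S, Function.Injective fun i => (Φ i s).1.2 := fun s i j hij => by
    have h := cov.eq_of_comp_eq (Φ i).continuous (Φ j).continuous
      ((hΦ i).2.trans (hΦ j).2.symm) s
      (Subtype.ext (Prod.ext ((hΦfst i s).trans (hΦfst j s).symm) hij))
    have h₀ := congrFun h ⟨s₀, hs₀⟩
    rw [(hΦ i).1, (hΦ j).1] at h₀
    exact hξinj (congrArg (fun z => z.1.2) h₀)
  classical
  have hφ : ∀ i (s : S), (if hs : (s : E) ∈ S then (Φ i ⟨s, hs⟩).1.2 else 0) = (Φ i s).1.2 :=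
    fun i s => dif_pos s.2
  have hprod : ∀ s : S, (mkPoly d fun i => c i s) = ∏ i, (X - C (Φ i s).1.2) := fun s => by
    obtain ⟨η, hη⟩ := exists_mkPoly_eq_prod d fun i => c i s
    rw [hη]
    refine prod_X_sub_C_eq_of_injective (hΦinj s) fun i => ?_
    rw [← hη]
    exact hΦroot i s
  refine ⟨fun i s => if hs : s ∈ S then (Φ i ⟨s, hs⟩).1.2 else 0, fun i s hs => ?_,
    fun s hs => ?_, fun s hs => ?_, fun ψ hψ hψr => ?_⟩
  · obtain ⟨ψ, hψ₀, hψd, -, hψr⟩ :=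
      exists_local_root_mkPoly (fun i => hc i s hs) (hdisc s hs) (hΦroot i ⟨s, hs⟩)
    refine (hψd.congr_of_eventuallyEq ?_).differentiableWithinAt
    have hcont : ContinuousAt (fun s => if hs : s ∈ S then (Φ i ⟨s, hs⟩).1.2 else 0) s := by
      refine ContinuousOn.continuousAt ?_ (hSo.mem_nhds hs)
      rw [continuousOn_iff_continuous_domRestrict]
      have : Continuous fun s : S => (Φ i s).1.2 := by fun_prop
      exact this.congr fun s => (hφ i s).symm
    have ht := (continuousAt_id.prodMk hcont).tendsto
    simp only [id_eq, hs, dif_pos] at ht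
    filter_upwards [ht.eventually hψr, hSo.mem_nhds hs] with s' h' hs'
    rw [dif_pos hs'] at h' ⊢
    exact (h'.1 (hΦroot i ⟨s', hs'⟩)).symm
  · simpa only [dif_pos hs] using hprod ⟨s, hs⟩
  · simpa only [dif_pos hs] using hΦinj ⟨s, hs⟩
  · obtain ⟨i, hi⟩ := (eval_prod_X_sub_C_eq_zero_iff ξ _).1 (by rw [← hξ]; exact hψr s₀ hs₀)
    refine ⟨i, fun s hs => ?_⟩
    have hψc : Continuous fun s : S =>
        (⟨(s, ψ s), hψr s s.2⟩ : {z : S × ℂ // (mkPoly d fun i => c i z.1).eval z.2 = 0}) :=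
      (continuous_id.prodMk (continuousOn_iff_continuous_domRestrict.1 hψ)).subtype_mk _
    have h := cov.eq_of_comp_eq hψc (Φ i).continuous ((hΦ i).2.symm ▸ rfl) ⟨s₀, hs₀⟩ (by
      rw [(hΦ i).1]
      exact Subtype.ext (Prod.ext rfl hi))
    have h' := congrArg (fun z => z.1.2) (congrFun h ⟨s, hs⟩)
    simpa only [dif_pos hs] using h'

end Roots

section Puiseux

open Metric Set Filter Topology

theorem norm_le_of_eval_mkPoly_eq_zero {d : ℕ} {a : Fin d → ℂ} {B : ℝ} (ha : ∀ i, ‖a i‖ ≤ B)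
    {y : ℂ} (hy : (mkPoly d a).eval y = 0) : ‖y‖ ≤ 1 + d * B := by
  rw [eval_mkPoly] at hy
  rcases Nat.eq_zero_or_pos d with rfl | hd
  · simp at hy
  have hB : 0 ≤ B := (norm_nonneg _).trans (ha ⟨0, hd⟩)
  rcases le_or_gt ‖y‖ 1 with h1 | h1
  · have : 0 ≤ d * B := by positivity
    linarith
  have hle : ‖y‖ ^ d ≤ d * B * ‖y‖ ^ (d - 1) := by
    calc ‖y‖ ^ d = ‖∑ i : Fin d, a i * y ^ (d - (i.val + 1))‖ := by
          rw [← norm_pow, eq_neg_of_add_eq_zero_left hy, norm_neg]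
      _ ≤ ∑ _i : Fin d, B * ‖y‖ ^ (d - 1) := by
          refine norm_sum_le_of_le _ fun i _ => ?_
          rw [norm_mul, norm_pow]
          exact mul_le_mul (ha i) (pow_le_pow_right₀ h1.le (by omega)) (by positivity) hB
      _ = d * B * ‖y‖ ^ (d - 1) := by simp [mul_assoc]
  have hpow : ‖y‖ ^ d = ‖y‖ * ‖y‖ ^ (d - 1) := by
    rw [← pow_succ', Nat.sub_add_cancel hd]
  rw [hpow] at hle
  have := le_of_mul_le_mul_right hle (by positivity)
  linarith

theorem continuousOn_eval_mkPoly {Y : Type*} [TopologicalSpace Y] {d : ℕ} {a : Fin d → Y → ℂ}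
    {s : Set Y} (ha : ∀ i, ContinuousOn (a i) s) (y : ℂ) :
    ContinuousOn (fun p => (mkPoly d fun i => a i p).eval y) s := by
  simp only [eval_mkPoly]
  exact continuousOn_const.add (continuousOn_finsetSum _ fun i _ => (ha i).mul continuousOn_const)

/-- A family of functions permuted by a translation is invariant under some multiple of it. -/
theorem exists_period_of_permuted {Y : Type*} {d : ℕ} {φ : Fin d → Y × ℂ → ℂ} {S : Set (Y × ℂ)} {T : ℂ}
    (hST : ∀ t w, (t, w + T) ∈ S ↔ (t, w) ∈ S) (hSne : S.Nonempty)
    (hinj : ∀ s ∈ S, Function.Injective fun i => φ i s)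
    (hperm : ∀ i, ∃ j, ∀ t w, (t, w) ∈ S → φ i (t, w + T) = φ j (t, w)) :
    ∃ N : ℕ, 0 < N ∧ ∀ i (n : ℤ) t w, (t, w) ∈ S → φ i (t, w + n * (N * T)) = φ i (t, w) := by
  choose σ hσ using hperm
  have hσinj : Function.Injective σ := fun i j hij => by
    obtain ⟨⟨t, w⟩, hs⟩ := hSne
    exact hinj (t, w + T) ((hST t w).2 hs) ((hσ i t w hs).trans (hij ▸ (hσ j t w hs).symm))
  let τ : Equiv.Perm (Fin d) := Equiv.ofBijective σ (Finite.injective_iff_bijective.1 hσinj)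
  have hiter : ∀ (k : ℕ) i t w, (t, w) ∈ S →
      (t, w + k * T) ∈ S ∧ φ i (t, w + k * T) = φ ((τ ^ k) i) (t, w) := by
    intro k
    induction k with
    | zero => intro i t w hs; simpa using hs
    | succ k ih =>
      intro i t w hs
      have hmem := (ih i t w hs).1
      have hadd : w + (k + 1 : ℕ) * T = w + k * T + T := by push_cast; ring
      rw [hadd]
      refine ⟨(hST _ _).2 hmem, ?_⟩
      rw [hσ i t _ hmem, (ih _ t w hs).2, pow_succ]
      rfl
  have hN : ∀ i t w, (t, w) ∈ S → (t, w + orderOf τ * T) ∈ S ∧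
      φ i (t, w + orderOf τ * T) = φ i (t, w) := fun i t w hs => by
    simpa [pow_orderOf_eq_one] using hiter (orderOf τ) i t w hs
  have hSnat : ∀ (k : ℕ) t w, (t, w + k * T) ∈ S ↔ (t, w) ∈ S := by
    intro k
    induction k with
    | zero => simp
    | succ k ih =>
      intro t w
      have hadd : w + (k + 1 : ℕ) * T = w + k * T + T := by push_cast; ring
      rw [hadd, hST, ih]
  have hnat : ∀ (n : ℕ) i t w, (t, w) ∈ S →
      φ i (t, w + n * (orderOf τ * T)) = φ i (t, w) := by
    intro n
    induction n with
    | zero => simp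
    | succ n ih =>
      intro i t w hs
      have hadd : w + (n + 1 : ℕ) * (orderOf τ * T) =
          w + orderOf τ * T + n * (orderOf τ * T) := by push_cast; ring
      rw [hadd, ih i t _ (hN i t w hs).1, (hN i t w hs).2]
  refine ⟨orderOf τ, orderOf_pos τ, fun i n t w hs => ?_⟩
  obtain ⟨m, rfl | rfl⟩ := n.eq_nat_or_neg
  · simpa using hnat m i t w hs
  · have hmem : (t, w + (-(m : ℤ) : ℤ) * (orderOf τ * T)) ∈ S := by
      rw [← hSnat (m * orderOf τ)]
      convert hs using 2
      push_cast; ring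
    rw [← hnat m i t _ hmem]
    congr 2
    push_cast; ring

variable {E : Type*} [NormedAddCommGroup E] [NormedSpace ℂ E]

theorem differentiableAt_comp_log_of_periodic {g : E × ℂ → ℂ} {S : Set (E × ℂ)} (hS : IsOpen S)
    {N : ℕ} (hg : DifferentiableOn ℂ g S)
    (hper : ∀ (n : ℤ) t w, (t, w) ∈ S → g (t, w + n * (N * (2 * Real.pi * Complex.I))) = g (t, w))
    {t₀ : E} {u₀ : ℂ} (hu₀ : u₀ ≠ 0) (hmem : (t₀, N * Complex.log u₀) ∈ S) :
    DifferentiableAt ℂ (fun q : E × ℂ => g (q.1, N * Complex.log q.2)) (t₀, u₀) := by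
  set L : E × ℂ → E × ℂ := fun q => (q.1, N * (Complex.log u₀ + Complex.log (q.2 / u₀))) with hL
  have hL₀ : L (t₀, u₀) = (t₀, N * Complex.log u₀) := by simp [hL, div_self hu₀]
  have hLd : DifferentiableAt ℂ L (t₀, u₀) := by
    have h1 : DifferentiableAt ℂ (fun q : E × ℂ => Complex.log (q.2 / u₀)) (t₀, u₀) :=
      DifferentiableAt.clog (by fun_prop) (by simp [div_self hu₀])
    fun_prop
  have hgL : DifferentiableAt ℂ (fun q => g (L q)) (t₀, u₀) :=
    DifferentiableAt.comp (g := g) (f := L) (t₀, u₀)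
      (hg.differentiableAt (by rw [hL₀]; exact hS.mem_nhds hmem)) hLd
  refine hgL.congr_of_eventuallyEq ?_
  have hLS : ∀ᶠ q in 𝓝 (t₀, u₀), L q ∈ S :=
    hLd.continuousAt.eventually (by rw [hL₀]; exact hS.mem_nhds hmem)
  have hne : ∀ᶠ q : E × ℂ in 𝓝 (t₀, u₀), q.2 ≠ 0 :=
    continuousAt_snd.eventually_ne (y := (0 : ℂ)) hu₀
  filter_upwards [hLS, hne] with q hq hq0
  obtain ⟨n, hn⟩ := Complex.exp_eq_exp_iff_exists_int.1
    (show Complex.exp (Complex.log q.2) =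
      Complex.exp (Complex.log u₀ + Complex.log (q.2 / u₀)) by
        rw [Complex.exp_add, Complex.exp_log hq0, Complex.exp_log hu₀,
          Complex.exp_log (div_ne_zero hq0 hu₀), mul_div_cancel₀ _ hu₀])
  rw [← hper n _ _ hq, hn]
  congr 2
  ring

theorem exists_convex_preimage_exp {V : Set E} {R : ℝ} (hV : IsOpen V) (hVc : Convex ℝ V)
    (hVne : V.Nonempty) (hR : 0 < R) :
    ∃ S : Set (E × ℂ), IsOpen S ∧ Convex ℝ S ∧ S.Nonempty ∧
      ∀ s, s ∈ S ↔ s.1 ∈ V ∧ ‖Complex.exp s.2‖ < R := by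
  refine ⟨V ×ˢ {w | ‖Complex.exp w‖ < R}, hV.prod (isOpen_lt (by fun_prop) continuous_const),
    ?_, ?_, fun s => Iff.rfl⟩
  · refine hVc.prod ?_
    have : {w | ‖Complex.exp w‖ < R} = Complex.reCLM ⁻¹' Iio (Real.log R) := by
      ext w
      simp [Complex.norm_exp, Real.lt_log_iff_exp_lt hR]
    rw [this]
    exact (convex_Iio _).linear_preimage Complex.reLm
  · obtain ⟨t, ht⟩ := hVne
    refine ⟨(t, ((Real.log (R / 2) : ℝ) : ℂ)), ht, ?_⟩
    simp only [mem_ofPred_eq, Complex.norm_exp, Complex.ofReal_re]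
    rw [Real.exp_log (by positivity)]
    linarith

theorem exists_global_roots_mkPoly_of_convex [CompleteSpace E] {d : ℕ} {c : Fin d → E → ℂ}
    {S : Set E} (hSo : IsOpen S) (hSc : Convex ℝ S) (hSne : S.Nonempty)
    (hc : ∀ i, AnalyticOnNhd ℂ (c i) S)
    (hdisc : ∀ s ∈ S, polyDisc (mkPoly d fun i => c i s) ≠ 0) :
    ∃ φ : Fin d → E → ℂ, (∀ i, DifferentiableOn ℂ (φ i) S) ∧
      (∀ s ∈ S, (mkPoly d fun i => c i s) = ∏ i, (X - C (φ i s))) ∧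
      (∀ s ∈ S, Function.Injective fun i => φ i s) ∧
      ∀ ψ : E → ℂ, ContinuousOn ψ S → (∀ s ∈ S, (mkPoly d fun i => c i s).eval (ψ s) = 0) →
        ∃ i, ∀ s ∈ S, ψ s = φ i s := by
  have : ContractibleSpace S := hSc.contractibleSpace hSne
  have : LocallyPathConnectedSpace S := hSo.locallyPathConnectedSpace
  exact exists_global_roots_mkPoly hSo hSne hc hdisc

/-- The Puiseux theorem with parameters: over a convex base, a monic polynomial whose discriminant
vanishes at most along `{x = 0}` splits after the substitution `x = u ^ N`. -/
theorem exists_puiseux_mkPoly [FiniteDimensional ℂ E] {d : ℕ} {a : Fin d → E × ℂ → ℂ} {V : Set E}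
    {R : ℝ} (hV : IsOpen V) (hVc : Convex ℝ V) (hVne : V.Nonempty) (hR : 0 < R) (hR1 : R ≤ 1)
    (ha : ∀ i, AnalyticOnNhd ℂ (a i) (V ×ˢ ball 0 R))
    (hdisc : ∀ p ∈ V ×ˢ ball (0 : ℂ) R, p.2 ≠ 0 → polyDisc (mkPoly d fun i => a i p) ≠ 0) :
    ∃ N : ℕ, 0 < N ∧ ∃ ξ : Fin d → E × ℂ → ℂ, (∀ i, AnalyticOnNhd ℂ (ξ i) (V ×ˢ ball 0 R)) ∧
      ∀ p ∈ V ×ˢ ball (0 : ℂ) R,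
        (mkPoly d fun i => a i (p.1, p.2 ^ N)) = ∏ i, (X - C (ξ i p)) := by
  have : CompleteSpace E := FiniteDimensional.complete ℂ E
  obtain ⟨S, hSo, hSc, hSne, hSmem⟩ := exists_convex_preimage_exp hV hVc hVne hR
  have hmaps : ∀ s ∈ S, (s.1, Complex.exp s.2) ∈ V ×ˢ ball (0 : ℂ) R := fun s hs =>
    ⟨((hSmem s).1 hs).1, mem_ball_zero_iff.2 ((hSmem s).1 hs).2⟩
  have hca : ∀ i, AnalyticOnNhd ℂ (fun s : E × ℂ => a i (s.1, Complex.exp s.2)) S := by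
    intro i s hs
    have hf : AnalyticAt ℂ (fun s : E × ℂ => (s.1, Complex.exp s.2)) s :=
      analyticAt_fst.prod analyticAt_snd.cexp
    exact AnalyticAt.fun_comp (g := a i) (ha i _ (hmaps s hs)) hf
  obtain ⟨φ, hφd, hφp, hφi, hφu⟩ := exists_global_roots_mkPoly_of_convex hSo hSc hSne hca
    fun s hs => hdisc _ (hmaps s hs) (Complex.exp_ne_zero _)
  have hexp : ∀ w : ℂ, Complex.exp (w + 2 * Real.pi * Complex.I) = Complex.exp w :=
    Complex.exp_periodic
  have hST : ∀ t w, (t, w + 2 * Real.pi * Complex.I) ∈ S ↔ (t, w) ∈ S := fun t w => by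
    simp only [hSmem, hexp]
  obtain ⟨N, hN, hper⟩ := exists_period_of_permuted hST hSne hφi fun i => by
    obtain ⟨j, hj⟩ := hφu (fun s => φ i (s.1, s.2 + 2 * Real.pi * Complex.I))
      ((hφd i).continuousOn.comp (by fun_prop) fun s hs => (hST s.1 s.2).2 hs) fun s hs => by
        have h := hφp _ ((hST s.1 s.2).2 hs)
        simp only [hexp] at h
        rw [h, eval_prod_X_sub_C_eq_zero_iff]
        exact ⟨i, rfl⟩
    exact ⟨j, fun t w hs => hj (t, w) hs⟩
  have hexpN : ∀ u : ℂ, u ≠ 0 → Complex.exp (N * Complex.log u) = u ^ N := fun u hu => by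
    rw [Complex.exp_nat_mul, Complex.exp_log hu]
  have hpowR : ∀ u ∈ ball (0 : ℂ) R, u ^ N ∈ ball (0 : ℂ) R := fun u hu => by
    rw [mem_ball_zero_iff] at hu ⊢
    rw [norm_pow]
    exact (pow_le_of_le_one (norm_nonneg u) (hu.le.trans hR1) hN.ne').trans_lt hu
  have hlogS : ∀ t ∈ V, ∀ u ∈ ball (0 : ℂ) R, u ≠ 0 → (t, N * Complex.log u) ∈ S :=
    fun t ht u hu hu0 => (hSmem _).2 ⟨ht, by
      rw [hexpN u hu0]
      exact mem_ball_zero_iff.1 (hpowR u hu)⟩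
  have hfac : ∀ t ∈ V, ∀ u ∈ ball (0 : ℂ) R, u ≠ 0 →
      (mkPoly d fun i => a i (t, u ^ N)) = ∏ i, (X - C (φ i (t, N * Complex.log u))) := by
    intro t ht u hu hu0
    have := hφp _ (hlogS t ht u hu hu0)
    simpa only [hexpN u hu0] using this
  have hext : ∀ i, ∃ g : E × ℂ → ℂ, AnalyticOnNhd ℂ g (V ×ˢ ball 0 R) ∧
      ∀ p ∈ V ×ˢ ball (0 : ℂ) R, p.2 ≠ 0 → g p = φ i (p.1, N * Complex.log p.2) := by
    intro i
    refine exists_analytic_extension_prod_ball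
      (f := fun p => φ i (p.1, N * Complex.log p.2)) hV hR ?_ fun t ht => ?_
    · rintro ⟨t, u⟩ ⟨ht, hu, hu0⟩
      exact (differentiableAt_comp_log_of_periodic hSo (hφd i) (hper i) hu0
        (hlogS t ht u hu hu0)).differentiableWithinAt
    · have hcont : ∀ j, ContinuousAt (fun u : ℂ => a j (t, u ^ N)) 0 := fun j => by
        have hj : ContinuousAt (a j) (t, (0 : ℂ) ^ N) :=
          (ha j _ ⟨ht, hpowR 0 (mem_ball_self hR)⟩).continuousAt
        exact ContinuousAt.comp (f := fun u : ℂ => (t, u ^ N)) hj (by fun_prop)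
      set B : ℝ := ∑ j, (‖a j (t, (0 : ℂ) ^ N)‖ + 1) with hB
      have hle : ∀ᶠ u in 𝓝 (0 : ℂ), ∀ j, ‖a j (t, u ^ N)‖ ≤ B := by
        refine eventually_all.2 fun j => ?_
        have hlt : ‖a j (t, (0 : ℂ) ^ N)‖ < ‖a j (t, (0 : ℂ) ^ N)‖ + 1 := lt_add_one _
        filter_upwards [(hcont j).norm.eventually_lt_const hlt] with u hu
        exact hu.le.trans (Finset.single_le_sum
          (f := fun j => ‖a j (t, (0 : ℂ) ^ N)‖ + 1) (fun _ _ => by positivity)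
          (Finset.mem_univ j))
      refine ⟨1 + d * B + ‖φ i (t, N * Complex.log 0)‖, ?_⟩
      rw [eventually_map]
      filter_upwards [nhdsWithin_le_nhds hle, self_mem_nhdsWithin,
        nhdsWithin_le_nhds (ball_mem_nhds (0 : ℂ) hR)] with u hu hu0 huR
      refine (norm_sub_le _ _).trans (add_le_add_left ?_ _)
      refine norm_le_of_eval_mkPoly_eq_zero hu ?_
      rw [hfac t ht u huR hu0, eval_prod_X_sub_C_eq_zero_iff]
      exact ⟨i, rfl⟩
  choose ξ hξa hξφ using hext
  refine ⟨N, hN, ξ, hξa, fun p hp => Polynomial.funext fun y => ?_⟩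
  refine eqOn_prod_ball_of_eq_off_zero
    (h₁ := fun p => (mkPoly d fun i => a i (p.1, p.2 ^ N)).eval y)
    (h₂ := fun p => (∏ i, (X - C (ξ i p))).eval y) hV ?_ ?_ ?_ p hp
  · exact continuousOn_eval_mkPoly (fun i => (ha i).continuousOn.comp (by fun_prop)
      fun q hq => ⟨hq.1, hpowR _ hq.2⟩) y
  · simp only [Polynomial.eval_prod, eval_sub, eval_X, eval_C]
    exact continuousOn_finsetProd _ fun i _ => continuousOn_const.sub (hξa i).continuousOn
  · rintro ⟨t, u⟩ ⟨ht, hu⟩ hu0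
    dsimp only
    rw [hfac t ht u hu hu0]
    simp only [hξφ _ (t, u) ⟨ht, hu⟩ hu0]

end Puiseux

section Equisingular

open Metric Set Filter Topology

variable {E : Type*} [NormedAddCommGroup E]

theorem exists_ball_prod_ball_subset {W : Set (E × ℂ)} (hW : W ∈ 𝓝 (0 : E × ℂ)) :
    ∃ R : ℝ, 0 < R ∧ R ≤ 1 ∧ ball (0 : E) R ×ˢ ball (0 : ℂ) R ⊆ W := by
  obtain ⟨r, hr, h⟩ := Metric.mem_nhds_iff.1 hW
  refine ⟨min r 1, by positivity, min_le_right _ _, fun p hp => h ?_⟩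
  rw [← Prod.mk_zero_zero, ← ball_prod_same]
  exact ⟨ball_subset_ball (min_le_left _ _) hp.1, ball_subset_ball (min_le_left _ _) hp.2⟩

theorem ball_prod_ball_mem_nhds {R : ℝ} (hR : 0 < R) :
    ball (0 : E) R ×ˢ ball (0 : ℂ) R ∈ 𝓝 (0 : E × ℂ) :=
  prod_mem_nhds (ball_mem_nhds _ hR) (ball_mem_nhds _ hR)

variable [NormedSpace ℂ E]

/-- Each pairwise difference divides the discriminant. -/
theorem exists_mul_eq_polyDisc {d : ℕ} (ξ : Fin d → E × ℂ → ℂ) {U : Set (E × ℂ)}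
    (hξ : ∀ i, AnalyticOnNhd ℂ (ξ i) U) {i j : Fin d} (hij : i < j) :
    ∃ g, AnalyticOnNhd ℂ g U ∧
      ∀ p, (ξ i p - ξ j p) * g p = polyDisc (∏ i, (X - C (ξ i p))) := by
  refine ⟨fun p => (ξ i p - ξ j p) * ((∏ j' ∈ (Finset.Ioi i).erase j, (ξ j' p - ξ i p) ^ 2) *
    ∏ i' ∈ Finset.univ.erase i, ∏ j' ∈ Finset.Ioi i', (ξ j' p - ξ i' p) ^ 2), ?_, fun p => ?_⟩
  · refine ((hξ i).sub (hξ j)).mul (AnalyticOnNhd.mul ?_ ?_)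
    · exact Finset.analyticOnNhd_fun_prod _ fun j' _ => ((hξ j').sub (hξ i)).pow 2
    · exact Finset.analyticOnNhd_fun_prod _ fun i' _ =>
        Finset.analyticOnNhd_fun_prod _ fun j' _ => ((hξ j').sub (hξ i')).pow 2
  · rw [polyDisc_prod_X_sub_C, ← Finset.mul_prod_erase _ _ (Finset.mem_univ i),
      ← Finset.mul_prod_erase _ _ (Finset.mem_Ioi.2 hij)]
    ring

theorem roots_eq_zero_of_mkPoly_zero {d : ℕ} {ξ : Fin d → ℂ}
    (h : mkPoly d (fun _ => 0) = ∏ i, (X - C (ξ i))) (i : Fin d) : ξ i = 0 := by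
  have h0 := (eval_prod_X_sub_C_eq_zero_iff ξ (ξ i)).2 ⟨i, rfl⟩
  rw [← h, eval_mkPoly] at h0
  simp only [zero_mul, Finset.sum_const_zero, add_zero] at h0
  exact eq_zero_of_pow_eq_zero h0

theorem exists_puiseux_of_polyDisc_eq [FiniteDimensional ℂ E] {d : ℕ} {a : Fin d → E × ℂ → ℂ}
    {R : ℝ} (hR : 0 < R) (hR1 : R ≤ 1)
    (ha : ∀ i, AnalyticOnNhd ℂ (a i) (ball 0 R ×ˢ ball 0 R)) (ha0 : ∀ i, a i 0 = 0)
    {M : ℕ} {u : E × ℂ → ℂ} (hu : AnalyticOnNhd ℂ u (ball 0 R ×ˢ ball 0 R))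
    (hu0 : ∀ p ∈ ball (0 : E) R ×ˢ ball (0 : ℂ) R, u p ≠ 0)
    (hD : ∀ p ∈ ball (0 : E) R ×ˢ ball (0 : ℂ) R,
      polyDisc (mkPoly d fun i => a i p) = p.2 ^ M * u p) :
    ∃ N : ℕ, 0 < N ∧ ∃ ξ : Fin d → E × ℂ → ℂ,
      (∀ i, AnalyticOnNhd ℂ (ξ i) (ball 0 R ×ˢ ball 0 R)) ∧
      (∀ p ∈ ball (0 : E) R ×ˢ ball (0 : ℂ) R,
        (mkPoly d fun i => a i (p.1, p.2 ^ N)) = ∏ i, (X - C (ξ i p))) ∧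
      ∀ i j : Fin d, i < j → ∃ k : ℕ, 0 < k ∧
        ∃ v : E × ℂ → ℂ, AnalyticOnNhd ℂ v (ball 0 R ×ˢ ball 0 R) ∧
          (∀ p ∈ ball (0 : E) R ×ˢ ball (0 : ℂ) R, v p ≠ 0) ∧
          ∀ p ∈ ball (0 : E) R ×ˢ ball (0 : ℂ) R, ξ i p - ξ j p = p.2 ^ k * v p := by
  have hVne : (ball (0 : E) R).Nonempty := ⟨0, mem_ball_self hR⟩
  have h0 : (0 : E × ℂ) ∈ ball (0 : E) R ×ˢ ball (0 : ℂ) R := ⟨mem_ball_self hR, mem_ball_self hR⟩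
  obtain ⟨N, hN, ξ, hξ, hfac⟩ := exists_puiseux_mkPoly isOpen_ball (convex_ball _ _) hVne hR hR1 ha
    fun p hp hp0 => by
      rw [hD p hp]
      exact mul_ne_zero (pow_ne_zero _ hp0) (hu0 p hp)
  have hmaps : ∀ p ∈ ball (0 : E) R ×ˢ ball (0 : ℂ) R,
      (p.1, p.2 ^ N) ∈ ball (0 : E) R ×ˢ ball (0 : ℂ) R := fun p hp => by
    refine ⟨hp.1, ?_⟩
    have h := mem_ball_zero_iff.1 hp.2
    rw [mem_ball_zero_iff, norm_pow]
    exact (pow_le_of_le_one (norm_nonneg _) (h.le.trans hR1) hN.ne').trans_lt h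
  refine ⟨N, hN, ξ, hξ, hfac, fun i j hij => ?_⟩
  obtain ⟨g, hg, hgD⟩ := exists_mul_eq_polyDisc ξ hξ hij
  have huN : AnalyticOnNhd ℂ (fun p : E × ℂ => u (p.1, p.2 ^ N)) (ball 0 R ×ˢ ball 0 R) := by
    intro p hp
    have hf : AnalyticAt ℂ (fun p : E × ℂ => (p.1, p.2 ^ N)) p :=
      analyticAt_fst.prod (analyticAt_snd.pow N)
    exact AnalyticAt.fun_comp (g := u) (hu _ (hmaps p hp)) hf
  obtain ⟨k, v, hv, hv0, hvk⟩ := exists_eq_pow_mul_unit_of_mul_eq isOpen_ball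
    (convex_ball (0 : E) R).isPreconnected hR (N * M) (f₁ := fun p => ξ i p - ξ j p)
    ((hξ i).sub (hξ j)) hg huN (fun p hp => hu0 _ (hmaps p hp)) fun p hp => by
      rw [hgD, ← hfac p hp, pow_mul]
      exact hD _ (hmaps p hp)
  refine ⟨k, Nat.pos_of_ne_zero ?_, v, hv, hv0, hvk⟩
  rintro rfl
  have hz : ∀ i, ξ i 0 = 0 := roots_eq_zero_of_mkPoly_zero (by
    rw [← hfac 0 h0]
    congr 1
    ext i
    have : ((0 : E × ℂ).1, (0 : E × ℂ).2 ^ N) = 0 := by simp [hN.ne']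
    rw [this, ha0])
  have := hvk 0 h0
  simp only [hz, sub_self, pow_zero, one_mul] at this
  exact hv0 0 h0 this.symm

/-- A function which becomes `u ^ K` times a unit after the substitution `x = u ^ N` is itself a power
of `x` times a unit. -/
theorem exists_eq_pow_mul_unit_of_ramified [FiniteDimensional ℂ E] {D f : E × ℂ → ℂ} {V : Set E}
    {R : ℝ} {N K : ℕ} (hV : IsOpen V) (hVne : V.Nonempty) (hR : 0 < R) (hN : 0 < N)
    (hf : AnalyticOnNhd ℂ f (V ×ˢ ball 0 R)) (hf0 : ∀ p ∈ V ×ˢ ball (0 : ℂ) R, f p ≠ 0)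
    (hD : ∀ p ∈ V ×ˢ ball (0 : ℂ) R, D (p.1, p.2 ^ N) = p.2 ^ K * f p) :
    ∃ M : ℕ, ∃ w : E × ℂ → ℂ, AnalyticOnNhd ℂ w (V ×ˢ ball 0 (R ^ N)) ∧
      (∀ p ∈ V ×ˢ ball (0 : ℂ) (R ^ N), w p ≠ 0) ∧
      ∀ p ∈ V ×ˢ ball (0 : ℂ) (R ^ N), D p = p.2 ^ M * w p := by
  have hdvd : N ∣ K := by
    have hζ := Complex.isPrimitiveRoot_exp N hN.ne'
    set ζ := Complex.exp (2 * Real.pi * Complex.I / N)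
    have hmaps : ∀ p ∈ V ×ˢ ball (0 : ℂ) R, (p.1, ζ * p.2) ∈ V ×ˢ ball (0 : ℂ) R := fun p hp =>
      ⟨hp.1, by simpa [hζ.norm'_eq_one hN.ne'] using hp.2⟩
    obtain ⟨t, ht⟩ := hVne
    have h0 : (t, (0 : ℂ)) ∈ V ×ˢ ball (0 : ℂ) R := ⟨ht, mem_ball_self hR⟩
    have h := eqOn_prod_ball_of_eq_off_zero (h₁ := f) (h₂ := fun p => ζ ^ K * f (p.1, ζ * p.2)) hV
      hf.continuousOn (continuousOn_const.mul (hf.continuousOn.comp (by fun_prop) hmaps))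
      (fun p hp hp0 => by
        have h1 := hD _ (hmaps p hp)
        simp only [mul_pow, hζ.pow_eq_one, one_mul, hD p hp] at h1
        refine mul_left_cancel₀ (pow_ne_zero K hp0) (h1.trans ?_)
        ring) _ h0
    simp only [mul_zero] at h
    exact hζ.dvd_of_pow_eq_one _ (mul_right_cancel₀ (hf0 _ h0) (by rw [one_mul]; exact h.symm))
  obtain ⟨M, rfl⟩ := hdvd
  have hroot : ∀ r : ℝ, 0 ≤ r → ∀ x ∈ ball (0 : ℂ) (r ^ N), ∃ u ∈ ball (0 : ℂ) r, u ^ N = x := by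
    intro r hr x hx
    obtain ⟨u, hu⟩ := IsAlgClosed.exists_pow_nat_eq x hN
    refine ⟨u, ?_, hu⟩
    rw [mem_ball_zero_iff, ← hu, norm_pow] at hx
    exact mem_ball_zero_iff.2 (lt_of_pow_lt_pow_left₀ N hr hx)
  have hpow : ∀ u ∈ ball (0 : ℂ) R, u ^ N ∈ ball (0 : ℂ) (R ^ N) := fun u hu => by
    rw [mem_ball_zero_iff] at hu ⊢
    rw [norm_pow]
    exact pow_lt_pow_left₀ hu (norm_nonneg _) hN.ne'
  have hquot : ∀ t ∈ V, ∀ u ∈ ball (0 : ℂ) R, u ≠ 0 →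
      D (t, u ^ N) / (u ^ N) ^ M = f (t, u) := fun t ht u hu hu0 => by
    rw [hD (t, u) ⟨ht, hu⟩, ← pow_mul, mul_div_cancel_left₀ _ (pow_ne_zero _ hu0)]
  obtain ⟨w, hw, hwD⟩ := exists_analytic_extension_prod_ball
    (f := fun p => D p / p.2 ^ M) hV (pow_pos hR N) (by
      rintro ⟨t, x⟩ ⟨ht, hx, hx0⟩
      obtain ⟨u, hu, rfl⟩ := hroot R hR.le x hx
      have hu0 : u ≠ 0 := fun h => hx0 (by simp [h, hN.ne'])
      set L : E × ℂ → E × ℂ := fun q => (q.1, u * Complex.exp (Complex.log (q.2 / u ^ N) / N))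
      have hL₀ : L (t, u ^ N) = (t, u) := by simp [L, div_self (pow_ne_zero N hu0)]
      have hLd : DifferentiableAt ℂ L (t, u ^ N) := by
        have h1 : DifferentiableAt ℂ (fun q : E × ℂ => Complex.log (q.2 / u ^ N)) (t, u ^ N) :=
          DifferentiableAt.clog (by fun_prop) (by simp [div_self (pow_ne_zero N hu0)])
        fun_prop
      have hfL : DifferentiableAt ℂ (fun q => f (L q)) (t, u ^ N) :=
        DifferentiableAt.comp (g := f) (f := L) (t, u ^ N)
          (by rw [hL₀]; exact (hf (t, u) ⟨ht, hu⟩).differentiableAt) hLd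
      refine (hfL.congr_of_eventuallyEq ?_).differentiableWithinAt
      have hLS : ∀ᶠ q in 𝓝 (t, u ^ N), L q ∈ V ×ˢ ball (0 : ℂ) R :=
        hLd.continuousAt.eventually (by
          rw [hL₀]; exact (hV.prod isOpen_ball).mem_nhds ⟨ht, hu⟩)
      have hne : ∀ᶠ q : E × ℂ in 𝓝 (t, u ^ N), q.2 ≠ 0 :=
        continuousAt_snd.eventually_ne (y := (0 : ℂ)) (pow_ne_zero N hu0)
      filter_upwards [hLS, hne] with q hq hq0
      have hLN : (L q).2 ^ N = q.2 := by
        have hN0 : (N : ℂ) ≠ 0 := Nat.cast_ne_zero.2 hN.ne'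
        simp only [L]
        rw [mul_pow, ← Complex.exp_nat_mul, mul_div_cancel₀ _ hN0,
          Complex.exp_log (div_ne_zero hq0 (pow_ne_zero N hu0)),
          mul_div_cancel₀ _ (pow_ne_zero N hu0)]
      have hL0 : (L q).2 ≠ 0 := fun h => hq0 (by rw [← hLN, h, zero_pow hN.ne'])
      have := hquot _ hq.1 _ hq.2 hL0
      rw [hLN] at this
      exact this)
    (fun t ht => by
      have hcont : ContinuousAt (fun u : ℂ => f (t, u)) 0 :=
        ContinuousAt.comp (g := f) (f := fun u : ℂ => (t, u))
          (hf _ ⟨ht, mem_ball_self hR⟩).continuousAt (by fun_prop)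
      obtain ⟨δ, hδ, hδf⟩ := Metric.eventually_nhds_iff_ball.1
        (hcont.norm.eventually_lt_const (lt_add_one ‖f (t, 0)‖))
      refine ⟨‖f (t, 0)‖ + 1 + ‖D (t, 0) / (0 : ℂ) ^ M‖, ?_⟩
      rw [eventually_map]
      have hr : 0 < min δ R := lt_min hδ hR
      filter_upwards [self_mem_nhdsWithin,
        nhdsWithin_le_nhds (ball_mem_nhds (0 : ℂ) (pow_pos hr N))] with x hx0 hx
      obtain ⟨u, hu, rfl⟩ := hroot _ hr.le x hx
      have hu0 : u ≠ 0 := fun h => hx0 (by simp [h, hN.ne'])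
      refine (norm_sub_le _ _).trans (add_le_add_left ?_ _)
      rw [hquot t ht u (ball_subset_ball (min_le_right _ _) hu) hu0]
      exact (hδf u (ball_subset_ball (min_le_left _ _) hu)).le)
  have hwf := eqOn_prod_ball_of_eq_off_zero (h₁ := fun p => w (p.1, p.2 ^ N)) (h₂ := f) hV
    (hw.continuousOn.comp (by fun_prop) fun p hp => ⟨hp.1, hpow _ hp.2⟩) hf.continuousOn
    (fun p hp hp0 => (hwD (p.1, p.2 ^ N) ⟨hp.1, hpow _ hp.2⟩ (pow_ne_zero N hp0)).trans
      (hquot p.1 hp.1 p.2 hp.2 hp0))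
  refine ⟨M, w, hw, ?_, ?_⟩
  · rintro ⟨t, x⟩ ⟨ht, hx⟩
    obtain ⟨u, hu, rfl⟩ := hroot R hR.le x hx
    have h := hwf (t, u) ⟨ht, hu⟩
    exact h ▸ hf0 _ ⟨ht, hu⟩
  · rintro ⟨t, x⟩ ⟨ht, hx⟩
    obtain ⟨u, hu, rfl⟩ := hroot R hR.le x hx
    have h := hwf (t, u) ⟨ht, hu⟩
    dsimp only at h ⊢
    rw [h, ← pow_mul]
    exact hD (t, u) ⟨ht, hu⟩

end Equisingular

/-- Let `F(t,x,y) = y^d + Σ aᵢ(t,x) y^{d-i}` be reduced with `aᵢ(0,0) = 0`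
and `T ⊂ V(F)`.  Then `V(F)` is an equisingular family of plane curve singularities
(discriminant of the form `x^M · unit`) if and only if there are germs `ξ̃ᵢ ∈ ℂ{t,u}` and
strictly positive integers `N`, `k_{ij}` (`i < j`) such that
`F(t,u^N,y) = ∏ (y - ξ̃ᵢ(t,u))` and `ξ̃ᵢ - ξ̃ⱼ = u^{k_{ij}} · unit(t,u)`. -/
theorem equisingular_iff_puiseux_with_parameter
    (l d : ℕ) (hd : 0 < d)
    (a : Fin d → (Fin l → ℂ) × ℂ → ℂ)
    (W : Set ((Fin l → ℂ) × ℂ)) (hW : W ∈ nhds (0 : (Fin l → ℂ) × ℂ))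
    (ha : ∀ i, AnalyticOnNhd ℂ (a i) W)
    (ha0 : ∀ i, a i 0 = 0)
    -- `F` is reduced: its discriminant does not vanish identically near `0`
    (hred : ¬ ∀ᶠ p in nhds (0 : (Fin l → ℂ) × ℂ), polyDisc (mkPoly d fun i => a i p) = 0)
    -- `T ⊂ V(F)`
    (hT : ∀ t : Fin l → ℂ, (t, (0 : ℂ)) ∈ W →
      Polynomial.eval 0 (mkPoly d fun i => a i (t, 0)) = 0) :
    -- equisingularity of the family
    (∃ M : ℕ, ∃ W' ∈ nhds (0 : (Fin l → ℂ) × ℂ), ∃ u : (Fin l → ℂ) × ℂ → ℂ,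
        AnalyticOnNhd ℂ u W' ∧ (∀ p ∈ W', u p ≠ 0) ∧
        ∀ p ∈ W', polyDisc (mkPoly d fun i => a i p) = p.2 ^ M * u p)
    ↔
    (∃ N : ℕ, 0 < N ∧ ∃ k : Fin d → Fin d → ℕ, (∀ i j : Fin d, i < j → 0 < k i j) ∧
      ∃ B ∈ nhds (0 : (Fin l → ℂ) × ℂ), ∃ ξ : Fin d → (Fin l → ℂ) × ℂ → ℂ,
        (∀ i, AnalyticOnNhd ℂ (ξ i) B) ∧
        (∀ p ∈ B, (mkPoly d fun i => a i (p.1, p.2 ^ N)) = ∏ i, (X - C (ξ i p))) ∧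
        ∀ i j : Fin d, i < j →
          ∃ v : (Fin l → ℂ) × ℂ → ℂ, AnalyticOnNhd ℂ v B ∧ (∀ p ∈ B, v p ≠ 0) ∧
            ∀ p ∈ B, ξ i p - ξ j p = p.2 ^ (k i j) * v p) := by
  constructor
  · rintro ⟨M, W', hW', u, hu, hu0, hD⟩
    obtain ⟨R, hR, hR1, hsub⟩ := exists_ball_prod_ball_subset (Filter.inter_mem hW hW')
    have hsubW := hsub.trans Set.inter_subset_left
    have hsubW' := hsub.trans Set.inter_subset_right
    obtain ⟨N, hN, ξ, hξ, hfac, hdiff⟩ := exists_puiseux_of_polyDisc_eq hR hR1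
      (fun i => (ha i).mono hsubW) ha0 (hu.mono hsubW') (fun p hp => hu0 p (hsubW' hp))
      fun p hp => hD p (hsubW' hp)
    choose! k hk hv using hdiff
    exact ⟨N, hN, k, hk, _, ball_prod_ball_mem_nhds hR, ξ, hξ, hfac, hv⟩
  · rintro ⟨N, hN, k, hk, B, hB, ξ, hξ, hfac, hdiff⟩
    obtain ⟨R, hR, hR1, hsub⟩ := exists_ball_prod_ball_subset hB
    choose! v hv hv0 hvk using hdiff
    obtain ⟨M, w, hw, hw0, hwD⟩ := exists_eq_pow_mul_unit_of_ramified
      (D := fun p => polyDisc (mkPoly d fun i => a i p))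
      (f := fun p => ∏ i, ∏ j ∈ Ioi i, v i j p ^ 2) (K := ∑ i, ∑ j ∈ Ioi i, k i j * 2)
      Metric.isOpen_ball ⟨0, Metric.mem_ball_self hR⟩ hR hN
      (Finset.analyticOnNhd_fun_prod _ fun i _ => Finset.analyticOnNhd_fun_prod _ fun j hj =>
        ((hv i j (Finset.mem_Ioi.1 hj)).mono hsub).pow 2)
      (fun p hp => Finset.prod_ne_zero_iff.2 fun i _ => Finset.prod_ne_zero_iff.2 fun j hj =>
        pow_ne_zero 2 (hv0 i j (Finset.mem_Ioi.1 hj) p (hsub hp)))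
      (fun p hp => by
        rw [hfac p (hsub hp), polyDisc_prod_X_sub_C, ← Finset.prod_pow_eq_pow_sum,
          ← Finset.prod_mul_distrib]
        refine Finset.prod_congr rfl fun i _ => ?_
        rw [← Finset.prod_pow_eq_pow_sum, ← Finset.prod_mul_distrib]
        refine Finset.prod_congr rfl fun j hj => ?_
        rw [← neg_sub, hvk i j (Finset.mem_Ioi.1 hj) p (hsub hp), neg_sq, mul_pow, pow_mul])
    exact ⟨M, _, prod_mem_nhds (Metric.ball_mem_nhds _ hR)
      (Metric.ball_mem_nhds _ (pow_pos hR N)), w, hw, hw0, hwD⟩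
end
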